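/- arXiv:1706.05887 — 3 statements merged into one kernel-verified Lean document; each statement's English description precedes it below -/
import Mathlib

section
/- Let n ≥ 1 be an integer, ξ ∈ F_q((T^{-1})), and k ≥ 0 the integer with p^k ≤ n < p^{k+1}. Then w_n(ξ)/p^k − n + 2/p^k − 1 ≤ w_n*(ξ) ≤ w_n(ξ) (as an inequality in the extended reals). -/
open Polynomial Filter Set
open scoped Classical

noncomputable section

namespace OotoT

variable (Fq : Type) [Field Fq]

/-- We model the field `F_q((T⁻¹))` of Laurent series in `T⁻¹` as `LaurentSeries Fq`,
whose canonical variable `u` plays the role of `T⁻¹`.  Thus `T` itself is `u⁻¹`. -/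
def Tel : LaurentSeries Fq := (HahnSeries.single (1 : ℤ) (1 : Fq))⁻¹

/-- The canonical ring embedding `F_q[T] → F_q((T⁻¹))`, sending `T ↦ u⁻¹`. -/
def ringHomT : Polynomial Fq →+* LaurentSeries Fq :=
  Polynomial.eval₂RingHom (HahnSeries.C : Fq →+* LaurentSeries Fq) (Tel Fq)

/-- The absolute value on `F_q((T⁻¹))`: `|0| = 0` and `|ξ| = q^{-N}` where
`ξ = Σ_{n ≥ N} a_n T^{-n}` with `a_N ≠ 0`; in our model `N` is the order of `ξ`
as a Hahn series in `u = T⁻¹`. -/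
def absL (q : ℕ) (ξ : LaurentSeries Fq) : ℝ :=
  if ξ = 0 then 0 else (q : ℝ) ^ (-ξ.order)

/-- Evaluation of a polynomial `P(X) ∈ (F_q[T])[X]` at `ξ ∈ F_q((T⁻¹))`. -/
def evalP (ξ : LaurentSeries Fq) (P : Polynomial (Polynomial Fq)) : LaurentSeries Fq :=
  Polynomial.eval₂ (ringHomT Fq) ξ P

/-- The height of `P(X) ∈ (F_q[T])[X]`: the maximum of the absolute values of its
coefficients.  A nonzero `c ∈ F_q[T]` has `|c| = q^{deg c}`, so for `P ≠ 0` the height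
is `q` raised to the maximal degree of a (nonzero) coefficient of `P`. -/
def heightP (q : ℕ) (P : Polynomial (Polynomial Fq)) : ℝ :=
  if P = 0 then 0 else (q : ℝ) ^ (P.support.sup fun i => (P.coeff i).natDegree)

/-- `w_n(ξ)`: the supremum (in the extended reals) of the real numbers `w` such that
`0 < |P(ξ)| ≤ H(P)^{-w}` for infinitely many `P(X) ∈ (F_q[T])[X]` of degree at most `n`. -/
def wn (q : ℕ) (n : ℕ) (ξ : LaurentSeries Fq) : EReal :=
  sSup ((fun w : ℝ => (w : EReal)) ''
    {w : ℝ | {P : Polynomial (Polynomial Fq) | P.natDegree ≤ n ∧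
      0 < absL Fq q (evalP Fq ξ P) ∧
      absL Fq q (evalP Fq ξ P) ≤ heightP Fq q P ^ (-w)}.Infinite})

/-- `w(ξ) = limsup_{n→∞} w_n(ξ)/n`. -/
def wB (q : ℕ) (ξ : LaurentSeries Fq) : EReal :=
  Filter.limsup (fun n : ℕ => wn Fq q n ξ / (n : EReal)) Filter.atTop

/-- `ξ` is an `A`-number if `w(ξ) = 0`. -/
def IsANumber (q : ℕ) (ξ : LaurentSeries Fq) : Prop := wB Fq q ξ = 0

/-- `ξ` is an `S`-number if `0 < w(ξ) < +∞`. -/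
def IsSNumber (q : ℕ) (ξ : LaurentSeries Fq) : Prop := 0 < wB Fq q ξ ∧ wB Fq q ξ < ⊤

/-- `ξ` is a `T`-number if `w(ξ) = +∞` and `w_n(ξ) < +∞` for all `n ≥ 1`. -/
def IsTNumber (q : ℕ) (ξ : LaurentSeries Fq) : Prop :=
  wB Fq q ξ = ⊤ ∧ ∀ n : ℕ, 1 ≤ n → wn Fq q n ξ < ⊤

/-- `ξ` is a `U`-number if `w(ξ) = +∞` and `w_n(ξ) = +∞` for some `n ≥ 1`. -/
def IsUNumber (q : ℕ) (ξ : LaurentSeries Fq) : Prop :=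
  wB Fq q ξ = ⊤ ∧ ∃ n : ℕ, 1 ≤ n ∧ wn Fq q n ξ = ⊤

/-- The type `t(ξ) = limsup_{n→∞} (log w_n(ξ))/(log n)` of a `T`-number (as an
extended real; for a `T`-number each `w_n(ξ)` is a finite real, recovered by `toReal`). -/
def typeT (q : ℕ) (ξ : LaurentSeries Fq) : EReal :=
  Filter.limsup
    (fun n : ℕ => ((Real.log (wn Fq q n ξ).toReal / Real.log n : ℝ) : EReal)) Filter.atTop

/-! ### The algebraic closure side -/

/-- The algebraic closure of `F_q((T⁻¹))`. -/
abbrev AC := AlgebraicClosure (LaurentSeries Fq)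

/-- The canonical embedding of `F_q((T⁻¹))` into its algebraic closure. -/
def iota : LaurentSeries Fq →+* AC Fq := algebraMap _ _

/-- The embedding `F_q[T] → AC`. -/
def ringHomTC : Polynomial Fq →+* AC Fq := (iota Fq).comp (ringHomT Fq)

/-- Evaluation of `P(X) ∈ (F_q[T])[X]` at an element of the algebraic closure. -/
def evalPC (α : AC Fq) (P : Polynomial (Polynomial Fq)) : AC Fq :=
  Polynomial.eval₂ (ringHomTC Fq) α P

/-- `P ∈ (F_q[T])[X]` is *the* minimal polynomial of `α`: it is non-constant, irreducible,
primitive, its leading coefficient is monic (in `T`), and `P(α) = 0`.  For `α` algebraic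
over `F_q(T)` such a polynomial exists and is unique. -/
def IsMinPolyOf (α : AC Fq) (P : Polynomial (Polynomial Fq)) : Prop :=
  0 < P.natDegree ∧ Irreducible P ∧ P.IsPrimitive ∧ P.leadingCoeff.Monic ∧ evalPC Fq α P = 0

/-- `α` is algebraic over `F_q(T)`. -/
def IsAlgT (α : AC Fq) : Prop := ∃ P, IsMinPolyOf Fq α P

/-- The degree of an algebraic `α`: the degree of its minimal polynomial. -/
def degT (α : AC Fq) : ℕ := if h : IsAlgT Fq α then h.choose.natDegree else 0

/-- The height of an algebraic `α`: the height of its minimal polynomial. -/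
def heightT (q : ℕ) (α : AC Fq) : ℝ := if h : IsAlgT Fq α then heightP Fq q h.choose else 0

/-- The unique extension of the absolute value to the algebraic closure of `F_q((T⁻¹))`,
given by the standard formula `|x| = |N_{K(x)/K}(x)|^{1/[K(x):K]}`, i.e.
`|x| = |c₀|^{1/d}` where `c₀` is the constant coefficient and `d` the degree of the
minimal polynomial of `x` over `K = F_q((T⁻¹))`. -/
def absC (q : ℕ) (x : AC Fq) : ℝ :=
  absL Fq q ((minpoly (LaurentSeries Fq) x).coeff 0) ^
    (((minpoly (LaurentSeries Fq) x).natDegree : ℝ)⁻¹)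

/-- `w_n^*(ξ)`: the supremum (in the extended reals) of the real numbers `w` such that
`0 < |ξ - α| ≤ H(α)^{-w-1}` for infinitely many `α` algebraic over `F_q(T)` of degree
at most `n`. -/
def wnStar (q : ℕ) (n : ℕ) (ξ : LaurentSeries Fq) : EReal :=
  sSup ((fun w : ℝ => (w : EReal)) ''
    {w : ℝ | {α : AC Fq | IsAlgT Fq α ∧ degT Fq α ≤ n ∧
      0 < absC Fq q (iota Fq ξ - α) ∧
      absC Fq q (iota Fq ξ - α) ≤ heightT Fq q α ^ (-w - 1)}.Infinite})

/-- `w^*(ξ) = limsup_{n→∞} w_n^*(ξ)/n`. -/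
def wBStar (q : ℕ) (ξ : LaurentSeries Fq) : EReal :=
  Filter.limsup (fun n : ℕ => wnStar Fq q n ξ / (n : EReal)) Filter.atTop

/-- `ξ` is an `A*`-number if `w^*(ξ) = 0`. -/
def IsAStarNumber (q : ℕ) (ξ : LaurentSeries Fq) : Prop := wBStar Fq q ξ = 0

/-- `ξ` is a `T*`-number if `w^*(ξ) = +∞` and `w_n^*(ξ) < +∞` for all `n ≥ 1`. -/
def IsTStarNumber (q : ℕ) (ξ : LaurentSeries Fq) : Prop :=
  wBStar Fq q ξ = ⊤ ∧ ∀ n : ℕ, 1 ≤ n → wnStar Fq q n ξ < ⊤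

/-- The `*`-type `t^*(ξ) = limsup_{n→∞} (log w_n^*(ξ))/(log n)` of a `T*`-number. -/
def typeTStar (q : ℕ) (ξ : LaurentSeries Fq) : EReal :=
  Filter.limsup
    (fun n : ℕ => ((Real.log (wnStar Fq q n ξ).toReal / Real.log n : ℝ) : EReal)) Filter.atTop

/-! ### The Laurent series `ξ(r, m)` -/

/-- `r_j = r^{m_0 m_1 ⋯ m_j}`. -/
def rr (r : ℕ) (m : ℕ → ℕ) (j : ℕ) : ℕ := r ^ (∏ i ∈ Finset.range (j + 1), m i)

/-- `α_j(r, m) = Σ_{n=1}^∞ T^{-r_j^n}`, i.e. the power series in `u = T⁻¹` whose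
`k`-th coefficient is `1` exactly when `k = r_j^n` for some `n ≥ 1`. -/
def alphaJ (r : ℕ) (m : ℕ → ℕ) (j : ℕ) : LaurentSeries Fq :=
  HahnSeries.ofPowerSeries ℤ Fq (PowerSeries.mk fun k =>
    if ∃ n : ℕ, 1 ≤ n ∧ k = rr r m j ^ n then 1 else 0)

/-- `ξ_a(r, m) = Σ_{j=0}^∞ a_j α_j(r, m)`, described coefficientwise: the coefficient of
`T^{-k}` is the (finite) sum over `j` of `a_j` times the coefficient of `T^{-k}` in
`α_j(r, m)`. -/
def xiA (r : ℕ) (m : ℕ → ℕ) (a : ℕ → ℕ) : LaurentSeries Fq :=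
  HahnSeries.ofPowerSeries ℤ Fq (PowerSeries.mk fun k =>
    ∑ᶠ j : ℕ, (a j : Fq) * (if ∃ n : ℕ, 1 ≤ n ∧ k = rr r m j ^ n then 1 else 0))

/-- `ξ(r, m) = Σ_{j=0}^∞ α_j(r, m)`. -/
def xi (r : ℕ) (m : ℕ → ℕ) : LaurentSeries Fq := xiA Fq r m fun _ => 1

/-! ### Algebraicity and algebraic dependence over `F_q(T)` for Laurent series -/

/-- `ξ ∈ F_q((T⁻¹))` is algebraic over `F_q(T)`. -/
def IsAlgLS (ξ : LaurentSeries Fq) : Prop :=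
  ∃ P : Polynomial (Polynomial Fq), P ≠ 0 ∧ evalP Fq ξ P = 0

/-- Evaluation of a two-variable polynomial `F(X, Y) ∈ (F_q[T])[X, Y]` (coded as an
iterated polynomial ring, `T` innermost, then `X`, then `Y`) at `(ξ, η)`. -/
def evalXY (ξ η : LaurentSeries Fq) (F : Polynomial (Polynomial (Polynomial Fq))) :
    LaurentSeries Fq :=
  Polynomial.eval₂ (Polynomial.eval₂RingHom (ringHomT Fq) ξ) η F

/-- `ξ` and `η` are algebraically dependent over `F_q(T)`. -/
def AlgDep (ξ η : LaurentSeries Fq) : Prop :=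
  ∃ F : Polynomial (Polynomial (Polynomial Fq)), F ≠ 0 ∧ evalXY Fq ξ η F = 0

/-- `deg_X` of `F(X, Y) ∈ (F_q[T])[X, Y]` in our encoding. -/
def degX (F : Polynomial (Polynomial (Polynomial Fq))) : ℕ :=
  F.support.sup fun i => (F.coeff i).natDegree

/-- `F(X, Y) ∈ (F_q[T])[X, Y]` is primitive (in `X` and `Y`): no non-unit of `F_q[T]`
divides all of its coefficients. -/
def IsPrimitiveXY (F : Polynomial (Polynomial (Polynomial Fq))) : Prop :=
  ∀ c : Polynomial Fq, (∀ i j : ℕ, c ∣ ((F.coeff i).coeff j)) → IsUnit c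

end OotoT

open OotoT

open scoped NNReal WithZero

/-- The valuation of a nonzero Laurent series is given by its order. -/
theorem LaurentSeries.valuation_eq_exp_neg_order {K : Type*} [Field K] {f : LaurentSeries K}
    (hf : f ≠ 0) : (Valued.v f : ℤᵐ⁰) = WithZero.exp (-f.order) := by
  apply le_antisymm
  · rw [LaurentSeries.valuation_le_iff_coeff_lt_eq_zero]
    exact fun n hn => HahnSeries.coeff_eq_zero_of_lt_order hn
  · by_contra! h
    have h0 : (Valued.v f : ℤᵐ⁰) ≠ 0 := (Valuation.ne_zero_iff _).mpr hf
    have h1 : (Valued.v f : ℤᵐ⁰) ≤ WithZero.exp (-(f.order + 1)) := by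
      rw [← WithZero.exp_log h0] at h ⊢
      rw [WithZero.exp_lt_exp] at h
      rw [WithZero.exp_le_exp]
      omega
    rw [LaurentSeries.valuation_le_iff_coeff_lt_eq_zero] at h1
    exact HahnSeries.coeff_order_eq_zero.not.mpr hf (h1 f.order (by omega))

/-- The rank one structure on the valuation of `K((u))` normalised by `|u| = e⁻¹`. -/
@[reducible]
def laurentRankOne (K : Type*) [Field K] (e : ℝ≥0) (he : 1 < e) :
    (Valued.v : Valuation (LaurentSeries K) ℤᵐ⁰).RankOne where
  hom' := (WithZeroMulInt.toNNReal (e := e) (by positivity)).comp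
    MonoidWithZeroHom.ValueGroup₀.embedding
  strictMono' := (WithZeroMulInt.toNNReal_strictMono he).comp
    MonoidWithZeroHom.ValueGroup₀.embedding_strictMono
  exists_val_nontrivial := by
    refine ⟨HahnSeries.single 1 1, ?_, ?_⟩
    · rw [LaurentSeries.valuation_single_zpow]; exact WithZero.exp_ne_zero
    · rw [LaurentSeries.valuation_single_zpow, ← WithZero.exp_zero]
      intro h
      have := WithZero.exp_injective h
      omega

/-- There is a nonarchimedean absolute value on the algebraic closure of `F_q((T⁻¹))` which is
given by `absC` and extends `absL`. -/
theorem exists_absoluteValue (Fq : Type) [Field Fq] (q : ℕ) (hq : 1 < q) :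
    ∃ v : AbsoluteValue (AC Fq) ℝ, IsNonarchimedean v ∧ (∀ x, v x = absC Fq q x) ∧
      ∀ x, v (iota Fq x) = absL Fq q x := by
  have he : (1 : ℝ≥0) < (q : ℝ≥0) := by exact_mod_cast hq
  let hr := laurentRankOne Fq q he
  let := Valued.toNontriviallyNormedField (L := LaurentSeries Fq) (Γ₀ := ℤᵐ⁰)
  have : IsUltrametricDist (LaurentSeries Fq) := inferInstance
  have : CompleteSpace (LaurentSeries Fq) := LaurentSeries.instLaurentSeriesComplete
  have hnorm : ∀ x : LaurentSeries Fq, ‖x‖ = absL Fq q x := by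
    intro x
    rw [absL]
    split_ifs with h
    · simp [h]
    · rw [Valued.toNormedField.norm_def]
      change ((WithZeroMulInt.toNNReal (e := q) (by positivity) (MonoidWithZeroHom.ValueGroup₀.embedding
        (Valued.v.restrict x)) : ℝ≥0) : ℝ) = _
      rw [Valuation.embedding_restrict, LaurentSeries.valuation_eq_exp_neg_order h,
        WithZeroMulInt.toNNReal_neg_apply _ WithZero.exp_ne_zero]
      exact NNReal.coe_zpow _ _
  have hC : ∀ x, spectralNorm (LaurentSeries Fq) (AC Fq) x = absC Fq q x := by
    intro x
    rw [spectralNorm.spectralNorm_eq_norm_coeff_zero_rpow, hnorm, absC, one_div]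
  refine ⟨⟨⟨fun x => spectralNorm (LaurentSeries Fq) (AC Fq) x, ?_⟩, ?_, ?_, ?_⟩, ?_, ?_, ?_⟩
  · exact fun x y => map_mul (spectralMulAlgNorm (LaurentSeries Fq) (AC Fq)) x y
  · exact fun x => spectralNorm_nonneg x
  · exact fun x => map_eq_zero_iff_eq_zero (spectralMulAlgNorm (LaurentSeries Fq) (AC Fq))
  · exact fun x y => map_add_le_add (spectralMulAlgNorm (LaurentSeries Fq) (AC Fq)) x y
  · exact isNonarchimedean_spectralNorm
  · exact hC
  · exact fun x => (spectralNorm_extends x).trans (hnorm x)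

section Nonarchimedean

variable {L : Type*} [Field L] {v : AbsoluteValue L ℝ}

theorem abv_coeff_le_gaussNorm (P : L[X]) (i : ℕ) : v (P.coeff i) ≤ P.gaussNorm v 1 := by
  simpa using le_gaussNorm v P zero_le_one i

theorem one_le_gaussNorm_X_sub_C (a : L) : 1 ≤ (X - C a).gaussNorm v 1 := by
  have h : (X - C a).coeff 1 = 1 := by
    rw [coeff_sub, coeff_X_one, coeff_C_of_ne_zero one_ne_zero, sub_zero]
  calc (1 : ℝ) = v ((X - C a).coeff 1) := by rw [h, map_one]
    _ ≤ _ := abv_coeff_le_gaussNorm _ 1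

theorem gaussNorm_one_le_iff {P : L[X]} {B : ℝ} :
    P.gaussNorm v 1 ≤ B ↔ ∀ i, v (P.coeff i) ≤ B := by
  refine ⟨fun h i => (abv_coeff_le_gaussNorm P i).trans h, fun h => ?_⟩
  obtain ⟨i, hi⟩ := exists_eq_gaussNorm v 1 P
  simpa [hi] using h i

theorem abv_eval_le (hna : IsNonarchimedean v) (P : L[X]) (x : L) {n : ℕ} (hn : P.natDegree ≤ n) :
    v (P.eval x) ≤ P.gaussNorm v 1 * max 1 (v x) ^ n := by
  rw [eval_eq_sum_range]
  obtain ⟨i, hi, h⟩ := IsNonarchimedean.finset_image_add_of_nonempty hna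
    (fun i => P.coeff i * x ^ i) (t := Finset.range (P.natDegree + 1)) (by simp)
  refine h.trans ?_
  have hi' : i ≤ n := by simp at hi; omega
  rw [map_mul, map_pow]
  have h1 : v x ^ i ≤ max 1 (v x) ^ n :=
    (pow_le_pow_left₀ (v.nonneg _) (le_max_right _ _) _).trans
      (pow_le_pow_right₀ (le_max_left _ _) hi')
  exact mul_le_mul (abv_coeff_le_gaussNorm P i) h1 (pow_nonneg (v.nonneg _) _)
    (gaussNorm_nonneg v P zero_le_one)

theorem gaussNorm_le_of_X_sub_C_mul (hna : IsNonarchimedean v) (G : L[X]) (a : L) :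
    G.gaussNorm v 1 ≤ ((X - C a) * G).gaussNorm v 1 := by
  rw [gaussNorm_mul hna one_pos]
  exact le_mul_of_one_le_left (gaussNorm_nonneg v G zero_le_one) (one_le_gaussNorm_X_sub_C a)

/-- The value of a polynomial at a point is controlled by the distance to any root. -/
theorem abv_eval_le_sub_root (hna : IsNonarchimedean v) {P : L[X]} {a : L} (ha : P.eval a = 0)
    (x : L) {n : ℕ} (hn : P.natDegree ≤ n) :
    v (P.eval x) ≤ v (x - a) * (P.gaussNorm v 1 * max 1 (v x) ^ n) := by
  obtain ⟨G, rfl⟩ := dvd_iff_isRoot.mpr ha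
  by_cases hG : G = 0
  · simp [hG]
  rw [natDegree_mul (X_sub_C_ne_zero a) hG] at hn
  rw [eval_mul, map_mul]
  simp only [eval_sub, eval_X, eval_C]
  gcongr
  refine (abv_eval_le hna G x (by omega : G.natDegree ≤ n)).trans ?_
  gcongr
  exact gaussNorm_le_of_X_sub_C_mul hna G a

theorem abv_natCast_le_one (hna : IsNonarchimedean v) (n : ℕ) : v (n : L) ≤ 1 := by
  induction n with
  | zero => simp
  | succ n ih => simpa using (hna (n : L) 1).trans (max_le ih (by simp))

/-- A determinant is bounded by any product of bounds for the rows. -/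
theorem abv_det_le (hna : IsNonarchimedean v) {ι : Type*} [Fintype ι] [DecidableEq ι]
    (M : Matrix ι ι L) (r : ι → ℝ) (h : ∀ i j, v (M i j) ≤ r i) : v M.det ≤ ∏ i, r i := by
  rw [Matrix.det_apply]
  obtain ⟨σ, -, hσ⟩ := IsNonarchimedean.finset_image_add_of_nonempty hna
    (fun σ : Equiv.Perm ι => Equiv.Perm.sign σ • ∏ i, M (σ i) i)
    (t := Finset.univ) Finset.univ_nonempty
  refine hσ.trans ?_
  have : v (Equiv.Perm.sign σ • ∏ i, M (σ i) i) = ∏ i, v (M (σ i) i) := by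
    rcases Int.units_eq_one_or (Equiv.Perm.sign σ) with h | h <;> simp [h, map_prod]
  rw [this, ← Equiv.prod_comp σ r]
  exact Finset.prod_le_prod (fun _ _ => v.nonneg _) fun i _ => h _ _

theorem abv_discr_le (hna : IsNonarchimedean v) (f : L[X]) (hf : 0 < f.natDegree) :
    v f.discr ≤ f.gaussNorm v 1 ^ (2 * f.natDegree - 2) := by
  have hc : ∀ i, v (f.coeff i) ≤ f.gaussNorm v 1 := abv_coeff_le_gaussNorm f
  have h0 : 0 ≤ f.gaussNorm v 1 := gaussNorm_nonneg v f zero_le_one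
  have hd : ∀ i, v (f.derivative.coeff i) ≤ f.gaussNorm v 1 := by
    intro i
    rw [coeff_derivative, map_mul]
    have := abv_natCast_le_one hna (i + 1)
    push_cast at this
    exact (mul_le_of_le_one_right (v.nonneg _) this).trans (hc _)
  let i₀ : Fin (f.natDegree - 1 + f.natDegree) := ⟨2 * f.natDegree - 2, by omega⟩
  have hdet := abv_det_le hna f.sylvesterDeriv
    (fun i => if i = i₀ then 1 else f.gaussNorm v 1) (by
      intro i j
      rw [sylvesterDeriv, dif_neg hf.ne', Matrix.updateRow_apply]
      by_cases hi : i = i₀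
      · rw [if_pos hi, if_pos hi]
        split_ifs
        · simp
        · exact abv_natCast_le_one hna _
        · simp
      · rw [if_neg hi, if_neg hi]
        induction j using Fin.addCases with
        | left j => simp only [sylvester, Matrix.of_apply, Fin.addCases_left]; split_ifs <;> simp [*]
        | right j =>
          simp only [sylvester, Matrix.of_apply, Fin.addCases_right]; split_ifs <;> simp [hd, h0])
  rw [discr, map_mul, map_pow, AbsoluteValue.map_neg, map_one, one_pow, mul_one]
  refine hdet.trans_eq ?_
  rw [Finset.prod_ite]
  simp only [Finset.prod_const_one, one_mul, Finset.prod_const]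
  congr 1
  rw [Finset.filter_ne' Finset.univ i₀, Finset.card_erase_of_mem (Finset.mem_univ _)]
  simp
  omega

theorem abv_discr_X_sub_C_mul (G : L[X]) (b : L) (hG : 0 < G.natDegree) :
    v ((X - C b) * G).discr = v (G.eval b) ^ 2 * v G.discr := by
  have hG0 : G ≠ 0 := by rintro rfl; simp at hG
  have hdeg : ((X - C b) * G).natDegree = 1 + G.natDegree := by
    rw [natDegree_mul (X_sub_C_ne_zero b) hG0, natDegree_X_sub_C]
  have hder : derivative ((X - C b) * G) = (X - C b) * derivative G + G * 1 := by
    simp [derivative_mul]; ring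
  have hdG : (derivative G).natDegree ≤ G.natDegree - 1 := natDegree_derivative_le G
  have hd1 : (derivative ((X - C b) * G)).natDegree ≤ G.natDegree := by
    have := natDegree_derivative_le ((X - C b) * G)
    omega
  have h1 := resultant_deriv (f := (X - C b) * G)
    (natDegree_pos_iff_degree_pos.mp (by omega))
  have h2 := resultant_deriv (f := G) (natDegree_pos_iff_degree_pos.mp hG)
  have h3 : resultant ((X - C b) * G) (derivative ((X - C b) * G)) (1 + G.natDegree) G.natDegree =
      G.eval b * resultant G (derivative ((X - C b) * G)) G.natDegree G.natDegree := by
    have := resultant_mul_left (X - C b) G (derivative ((X - C b) * G)) G.natDegree hd1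
    rw [natDegree_X_sub_C, resultant_X_sub_C_left _ _ _ hd1] at this
    rw [this, hder]
    simp
  have h4 : resultant G (derivative ((X - C b) * G)) G.natDegree G.natDegree =
      (-1) ^ G.natDegree * G.eval b * resultant G (derivative G) G.natDegree (G.natDegree - 1) := by
    rw [hder, resultant_add_mul_right _ _ _ _ _ (by simp) le_rfl]
    obtain ⟨j, hj⟩ := Nat.exists_eq_add_of_le hdG
    have hmul : ((X - C b) * derivative G).natDegree ≤
        (X - C b).natDegree + (derivative G).natDegree := natDegree_mul_le
    have e1 : resultant G ((X - C b) * derivative G) G.natDegree G.natDegree =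
        resultant G ((X - C b) * derivative G) G.natDegree
          ((X - C b).natDegree + (derivative G).natDegree + j) := by
      congr 1
      rw [natDegree_X_sub_C]
      omega
    rw [e1, resultant_add_right_deg _ _ _ _ _ hmul, resultant_mul_right _ _ _ _ le_rfl, hj,
      resultant_add_right_deg _ _ _ _ _ le_rfl, natDegree_X_sub_C,
      resultant_X_sub_C_right _ _ _ le_rfl]
    ring
  have hlead : ((X - C b) * G).leadingCoeff = G.leadingCoeff := by simp
  rw [hdeg, Nat.add_sub_cancel_left, h3, h4, h2, hlead] at h1
  have h5 := congrArg v h1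
  simp only [map_mul, map_pow, AbsoluteValue.map_neg, map_one, one_pow, one_mul] at h5
  have : v G.leadingCoeff ≠ 0 := by simpa using hG0
  field_simp at h5
  linarith

/-- If `b` is a root of `(X - b) G` closest to `x`, then `|G(b)| ≤ |G(x)|`. -/
theorem abv_eval_le_of_closest (hna : IsNonarchimedean v) {G : L[X]} (hG : G.Splits) {x b : L}
    (hb : ∀ c ∈ G.roots, v (x - b) ≤ v (x - c)) : v (G.eval b) ≤ v (G.eval x) := by
  rw [hG.eval_eq_prod_roots, hG.eval_eq_prod_roots, map_mul, map_mul, map_multiset_prod,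
    map_multiset_prod, Multiset.map_map, Multiset.map_map]
  gcongr
  refine Multiset.prod_map_le_prod_map₀ _ _ (fun c _ => v.nonneg _) fun c hc => ?_
  have h1 := hna (b - x) (x - c)
  rw [sub_add_sub_cancel, v.map_sub b x, max_eq_right (hb c hc)] at h1
  exact h1

/-- Distance to the closest root in terms of the value of a polynomial whose discriminant
is bounded below. -/
theorem abv_sub_closest_root_le (hna : IsNonarchimedean v) {Q : L[X]} (hQ : Q.Splits)
    (hdeg : 0 < Q.natDegree) (hdisc : 1 ≤ v Q.discr) {x b : L} (hb : Q.eval b = 0)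
    (hclose : ∀ c ∈ Q.roots, v (x - b) ≤ v (x - c)) (hsmall : v (Q.eval x) < Q.gaussNorm v 1) :
    v (x - b) * Q.gaussNorm v 1 ^ 2 ≤
      v (Q.eval x) * Q.gaussNorm v 1 ^ Q.natDegree * max 1 (v x) := by
  obtain ⟨G, rfl⟩ := dvd_iff_isRoot.mpr hb
  have hG0 : G ≠ 0 := by rintro rfl; simp at hdeg
  have hQ0 := mul_ne_zero (X_sub_C_ne_zero b) hG0
  have hN : (0 : ℝ) ≤ ((X - C b) * G).gaussNorm v 1 := gaussNorm_nonneg v _ zero_le_one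
  have hdegQ : ((X - C b) * G).natDegree = 1 + G.natDegree := by
    rw [natDegree_mul (X_sub_C_ne_zero b) hG0, natDegree_X_sub_C]
  have heval : v (((X - C b) * G).eval x) = v (x - b) * v (G.eval x) := by simp
  rcases Nat.eq_zero_or_pos G.natDegree with h0 | hpos
  · rw [hdegQ, h0]
    obtain ⟨a, rfl⟩ : ∃ a, G = C a := ⟨_, eq_C_of_natDegree_eq_zero h0⟩
    have hgn : ((X - C b) * C a).gaussNorm v 1 ≤ v a * max 1 (v x) := by
      by_contra! hlt
      have hle : ∀ i, v (((X - C b) * C a).coeff i) ≤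
          max (v a * max 1 (v x)) (v (((X - C b) * C a).eval x)) := by
        intro i
        rw [coeff_mul_C, coeff_sub, coeff_X, coeff_C]
        match i with
        | 0 =>
          have h1 := hna (a * x) (-((x - b) * a))
          have h2 : a * x + -((x - b) * a) = b * a := by ring
          rw [h2, v.map_neg, map_mul v a x] at h1
          simp only [eval_mul, eval_sub, eval_X, eval_C, zero_sub, ↓reduceIte, one_ne_zero,
            neg_mul, v.map_neg]
          exact h1.trans (max_le_max (mul_le_mul_of_nonneg_left (le_max_right _ _) (v.nonneg _))
            le_rfl)
        | 1 =>
          simp only [one_ne_zero, ↓reduceIte, sub_zero, one_mul]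
          exact le_max_of_le_left (le_mul_of_one_le_right (v.nonneg _) (le_max_left _ _))
        | (j + 2) =>
          simp
      have := gaussNorm_one_le_iff.mpr hle
      rcases le_max_iff.mp this with h | h
      · exact absurd h (not_le.mpr hlt)
      · exact absurd h (not_le.mpr hsmall)
    rw [heval, eval_C]
    calc _ = v (x - b) * ((X - C b) * C a).gaussNorm v 1 * ((X - C b) * C a).gaussNorm v 1 := by
          ring
      _ ≤ v (x - b) * (v a * max 1 (v x)) * ((X - C b) * C a).gaussNorm v 1 := by gcongr
      _ = _ := by ring
  · have hGs : G.Splits := hQ.of_dvd hQ0 (dvd_mul_left _ _)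
    have hcl : v (G.eval b) ≤ v (G.eval x) := by
      refine abv_eval_le_of_closest hna hGs fun c hc => hclose c ?_
      rw [roots_mul hQ0]
      exact Multiset.mem_add.mpr (Or.inr hc)
    rw [abv_discr_X_sub_C_mul G b hpos] at hdisc
    generalize hNdef : ((X - C b) * G).gaussNorm v 1 = N at *
    have h1 : v G.discr ≤ N ^ (2 * G.natDegree - 2) :=
      (abv_discr_le hna G hpos).trans (pow_le_pow_left₀ (gaussNorm_nonneg v _ zero_le_one)
        (hNdef ▸ gaussNorm_le_of_X_sub_C_mul hna G b) _)
    have h2 : 1 ≤ (v (G.eval b) * N ^ (G.natDegree - 1)) ^ 2 := by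
      rw [mul_pow, ← pow_mul, show (G.natDegree - 1) * 2 = 2 * G.natDegree - 2 by omega]
      exact hdisc.trans (by gcongr)
    have h3 : 1 ≤ v (G.eval b) * N ^ (G.natDegree - 1) :=
      (one_le_sq_iff₀ (mul_nonneg (v.nonneg _) (pow_nonneg hN _))).mp h2
    rw [heval, hdegQ, show 1 + G.natDegree = G.natDegree - 1 + 2 by omega, pow_add]
    calc v (x - b) * N ^ 2 ≤ v (x - b) * N ^ 2 * (v (G.eval b) * N ^ (G.natDegree - 1)) :=
          le_mul_of_one_le_right (by positivity) h3
      _ ≤ v (x - b) * N ^ 2 * (v (G.eval x) * N ^ (G.natDegree - 1)) := by gcongr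
      _ = v (x - b) * v (G.eval x) * (N ^ (G.natDegree - 1) * N ^ 2) := by ring
      _ ≤ _ := le_mul_of_one_le_right (by positivity) (le_max_left _ _)

/-- The discriminant of a separable split polynomial is nonzero. -/
theorem discr_ne_zero_of_separable {Q : L[X]} (hQ : Q.Splits) (hdeg : 0 < Q.natDegree)
    (hsep : Q.Separable) : Q.discr ≠ 0 := by
  intro h
  have h1 := resultant_deriv (f := Q) (natDegree_pos_iff_degree_pos.mp hdeg)
  rw [h, mul_zero, resultant_eq_prod_eval _ _ _ (natDegree_derivative_le Q) hQ] at h1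
  clear h
  rcases mul_eq_zero.mp h1 with h2 | h2
  · have := leadingCoeff_eq_zero.mp (eq_zero_of_pow_eq_zero h2)
    simp [this] at hdeg
  · obtain ⟨c, hc, hc0⟩ := Multiset.mem_map.mp (Multiset.prod_eq_zero_iff.mp h2)
    have := hsep.eval₂_derivative_ne_zero (RingHom.id L) (x := c) (by
      simpa using (mem_roots'.mp hc).2)
    exact this (by simpa using hc0)

end Nonarchimedean

section Heights

variable {Fq : Type} [Field Fq] {q : ℕ} {v : AbsoluteValue (AC Fq) ℝ}

theorem abv_ringHomTC_X (hL : ∀ x, v (iota Fq x) = absL Fq q x) :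
    v (ringHomTC Fq X) = q := by
  have h : Tel Fq = HahnSeries.single (-1 : ℤ) (1 : Fq) := by
    rw [Tel, HahnSeries.inv_single, inv_one]
  rw [ringHomTC, RingHom.comp_apply, hL, ringHomT, coe_eval₂RingHom, eval₂_X, h, absL,
    if_neg (by simp), HahnSeries.order_single one_ne_zero]
  simp

theorem abv_ringHomTC_C (hL : ∀ x, v (iota Fq x) = absL Fq q x) {a : Fq} (ha : a ≠ 0) :
    v (ringHomTC Fq (C a)) = 1 := by
  rw [ringHomTC, RingHom.comp_apply, hL, ringHomT, coe_eval₂RingHom, eval₂_C, absL,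
    if_neg (by simpa using ha), HahnSeries.order_C]
  simp

theorem abv_ringHomTC_monomial (hL : ∀ x, v (iota Fq x) = absL Fq q x) {a : Fq} (ha : a ≠ 0)
    (i : ℕ) : v (ringHomTC Fq (monomial i a)) = (q : ℝ) ^ i := by
  rw [← C_mul_X_pow_eq_monomial, map_mul, map_pow, map_mul, map_pow, abv_ringHomTC_C hL ha,
    abv_ringHomTC_X hL, one_mul]

theorem abv_ringHomTC_le (hq : 1 < q) (hna : IsNonarchimedean v)
    (hL : ∀ x, v (iota Fq x) = absL Fq q x) (c : Fq[X]) {d : ℕ} (hd : c.natDegree ≤ d) :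
    v (ringHomTC Fq c) ≤ (q : ℝ) ^ d := by
  have hq' : (1 : ℝ) ≤ q := by exact_mod_cast hq.le
  rw [c.as_sum_range, map_sum]
  obtain ⟨i, hi, h⟩ := IsNonarchimedean.finset_image_add_of_nonempty hna
    (fun i => ringHomTC Fq (monomial i (c.coeff i))) (t := Finset.range (c.natDegree + 1)) (by simp)
  refine h.trans ?_
  by_cases h0 : c.coeff i = 0
  · simp only [h0, map_zero]
    positivity
  · simp only [Finset.mem_range] at hi
    rw [abv_ringHomTC_monomial hL h0]
    exact pow_le_pow_right₀ hq' (by omega)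

/-- The absolute value of a nonzero polynomial in `T` is `q ^ deg`. -/
theorem abv_ringHomTC (hq : 1 < q) (hna : IsNonarchimedean v)
    (hL : ∀ x, v (iota Fq x) = absL Fq q x) {c : Fq[X]} (hc : c ≠ 0) :
    v (ringHomTC Fq c) = (q : ℝ) ^ c.natDegree := by
  have hq' : (1 : ℝ) < q := by exact_mod_cast hq
  have hlead := abv_ringHomTC_monomial (v := v) hL (leadingCoeff_ne_zero.mpr hc) c.natDegree
  rcases Nat.eq_zero_or_pos c.natDegree with h0 | hpos
  · obtain ⟨a, rfl⟩ : ∃ a, c = C a := ⟨_, eq_C_of_natDegree_eq_zero h0⟩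
    simpa using abv_ringHomTC_C hL (by simpa using hc)
  · have herase : v (ringHomTC Fq c.eraseLead) < (q : ℝ) ^ c.natDegree :=
      (abv_ringHomTC_le hq hna hL _ (eraseLead_natDegree_le c)).trans_lt
        (pow_lt_pow_right₀ hq' (by omega))
    conv_lhs => rw [← c.eraseLead_add_monomial_natDegree_leadingCoeff, map_add]
    rw [IsNonarchimedean.add_eq_max_of_ne hna (by rw [hlead]; exact herase.ne), hlead,
      max_eq_right herase.le]

theorem one_le_abv_ringHomTC (hq : 1 < q) (hna : IsNonarchimedean v)
    (hL : ∀ x, v (iota Fq x) = absL Fq q x) {c : Fq[X]} (hc : c ≠ 0) :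
    1 ≤ v (ringHomTC Fq c) := by
  rw [abv_ringHomTC hq hna hL hc]
  exact one_le_pow₀ (by exact_mod_cast hq.le)

theorem ringHomTC_injective (hq : 1 < q) (hna : IsNonarchimedean v)
    (hL : ∀ x, v (iota Fq x) = absL Fq q x) : Function.Injective (ringHomTC Fq) := by
  rw [injective_iff_map_eq_zero]
  intro c h
  by_contra hc
  have := one_le_abv_ringHomTC hq hna hL hc
  rw [h, map_zero] at this
  linarith

/-- The height is the Gauss norm. -/
theorem heightP_eq_gaussNorm (hq : 1 < q) (hna : IsNonarchimedean v)
    (hL : ∀ x, v (iota Fq x) = absL Fq q x) (P : Fq[X][X]) :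
    heightP Fq q P = (P.map (ringHomTC Fq)).gaussNorm v 1 := by
  have hq' : (1 : ℝ) ≤ q := by exact_mod_cast hq.le
  by_cases hP : P = 0
  · simp [hP, heightP]
  rw [heightP, if_neg hP]
  apply le_antisymm
  · obtain ⟨i, hi, h⟩ := Finset.exists_mem_eq_sup P.support (support_nonempty.mpr hP)
      (fun i => (P.coeff i).natDegree)
    rw [h, ← abv_ringHomTC hq hna hL (mem_support_iff.mp hi), ← coeff_map]
    exact abv_coeff_le_gaussNorm _ i
  · rw [gaussNorm_one_le_iff]
    intro i
    rw [coeff_map]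
    by_cases h0 : P.coeff i = 0
    · simp only [h0, map_zero]
      positivity
    · rw [abv_ringHomTC hq hna hL h0]
      exact pow_le_pow_right₀ hq'
        (Finset.le_sup (f := fun i => (P.coeff i).natDegree) (mem_support_iff.mpr h0))

theorem one_le_heightP (hq : 1 < q) {P : Fq[X][X]} (hP : P ≠ 0) : 1 ≤ heightP Fq q P := by
  rw [heightP, if_neg hP]
  exact one_le_pow₀ (by exact_mod_cast hq.le)

theorem heightP_mul (hq : 1 < q) (hna : IsNonarchimedean v)
    (hL : ∀ x, v (iota Fq x) = absL Fq q x) (P R : Fq[X][X]) :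
    heightP Fq q (P * R) = heightP Fq q P * heightP Fq q R := by
  simp only [heightP_eq_gaussNorm hq hna hL, Polynomial.map_mul, gaussNorm_mul hna one_pos]

theorem heightP_C (c : Fq[X]) (hc : c ≠ 0) : heightP Fq q (C c) = (q : ℝ) ^ c.natDegree := by
  rw [heightP, if_neg (by simpa using hc), support_C hc]
  simp

theorem heightP_expand (f : ℕ) (hf : 0 < f) (Q : Fq[X][X]) :
    heightP Fq q (expand Fq[X] f Q) = heightP Fq q Q := by
  by_cases hQ : Q = 0
  · simp [hQ]
  rw [heightP, heightP, if_neg hQ, if_neg (by simpa [expand_eq_zero hf] using hQ)]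
  congr 1
  apply le_antisymm
  · refine Finset.sup_le fun i _ => ?_
    rw [coeff_expand hf]
    split_ifs with h
    · by_cases h0 : Q.coeff (i / f) = 0
      · simp [h0]
      · exact Finset.le_sup (f := fun i => (Q.coeff i).natDegree) (mem_support_iff.mpr h0)
    · simp
  · refine Finset.sup_le fun i hi => ?_
    have h : (expand Fq[X] f Q).coeff (i * f) = Q.coeff i := coeff_expand_mul hf Q i
    rw [← h]
    exact Finset.le_sup (f := fun i => ((expand Fq[X] f Q).coeff i).natDegree)
      (mem_support_iff.mpr (h ▸ mem_support_iff.mp hi))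

theorem iota_evalP (ξ : LaurentSeries Fq) (P : Fq[X][X]) :
    iota Fq (evalP Fq ξ P) = (P.map (ringHomTC Fq)).eval (iota Fq ξ) := by
  rw [evalP, hom_eval₂, eval_map, ringHomTC]

theorem evalPC_eq_eval_map (α : AC Fq) (P : Fq[X][X]) :
    evalPC Fq α P = (P.map (ringHomTC Fq)).eval α := by
  rw [evalPC, eval_map]

theorem finite_natDegree_le [Finite Fq] (M : ℕ) : {c : Fq[X] | c.natDegree ≤ M}.Finite := by
  have : Finite (degreeLT Fq (M + 1)) := Module.finite_of_finite Fq
  refine (Set.toFinite ((degreeLT Fq (M + 1) : Submodule Fq Fq[X]) : Set Fq[X])).subset ?_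
  intro c hc
  rw [SetLike.mem_coe, mem_degreeLT]
  exact degree_le_natDegree.trans_lt (by exact_mod_cast Nat.lt_succ_of_le hc)

/-- Northcott property. -/
theorem finite_heightP_le [Finite Fq] (hq : 1 < q) (n : ℕ) (B : ℝ) :
    {P : Fq[X][X] | P.natDegree ≤ n ∧ heightP Fq q P ≤ B}.Finite := by
  have hq' : (1 : ℝ) < q := by exact_mod_cast hq
  obtain ⟨M, hM⟩ := pow_unbounded_of_one_lt B hq'
  have hfin : {g : Fin (n + 1) → Fq[X] | ∀ i, g i ∈ {c : Fq[X] | c.natDegree ≤ M}}.Finite :=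
    Set.Finite.pi' fun _ => finite_natDegree_le M
  refine Set.Finite.of_finite_image (f := fun P => fun i : Fin (n + 1) => P.coeff i)
    (hfin.subset ?_) ?_
  · rintro _ ⟨P, ⟨-, hB⟩, rfl⟩ i
    by_cases h0 : P.coeff i = 0
    · simp [h0]
    have hP : P ≠ 0 := by rintro rfl; simp at h0
    rw [heightP, if_neg hP] at hB
    have h1 := (pow_lt_pow_iff_right₀ hq').mp (hB.trans_lt hM)
    exact (Finset.le_sup (f := fun i => (P.coeff i).natDegree)
      (mem_support_iff.mpr h0)).trans h1.le
  · rintro P ⟨hP, -⟩ R ⟨hR, -⟩ h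
    ext1 i
    by_cases hi : i < n + 1
    · exact congrFun h ⟨i, hi⟩
    · rw [coeff_eq_zero_of_natDegree_lt (by omega), coeff_eq_zero_of_natDegree_lt (by omega)]

end Heights

section MinimalPolynomials

variable {Fq : Type} [Field Fq]

/-- Two nonconstant irreducible polynomials with a common root are associated. -/
theorem associated_of_common_root {A L : Type*} [CommRing A] [IsDomain A] [NormalizedGCDMonoid A]
    [Field L] {φ : A →+* L} (hφ : Function.Injective φ) {P R : A[X]} (hP : Irreducible P)
    (hR : Irreducible R) (hPd : P.natDegree ≠ 0) {α : L}
    (h1 : (P.map φ).eval α = 0) (h2 : (R.map φ).eval α = 0) : Associated P R := by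
  have hPp := hP.isPrimitive hPd
  let ψ : FractionRing A →+* L := IsFractionRing.lift hφ
  have hψ : ψ.comp (algebraMap A (FractionRing A)) = φ := by
    ext x; exact IsFractionRing.lift_algebraMap hφ x
  have hP' := (hPp.irreducible_iff_irreducible_map_fraction_map (K := FractionRing A)).mp hP
  have hdvd : P.map (algebraMap A (FractionRing A)) ∣ R.map (algebraMap A (FractionRing A)) := by
    by_contra hnd
    obtain ⟨a, b, hab⟩ := (hP'.coprime_iff_not_dvd).mpr hnd
    have := congrArg (fun F => (F.map ψ).eval α) hab
    simp only [Polynomial.map_add, Polynomial.map_mul, Polynomial.map_map, hψ, eval_add, eval_mul,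
      h1, h2, Polynomial.map_one, eval_one] at this
    simp at this
  exact hP.associated_of_dvd hR ((IsPrimitive.dvd_iff_fraction_map_dvd_fraction_map
    (FractionRing A) hPp).mpr hdvd)

theorem eq_of_associated_of_monic {P R : Fq[X][X]} (h : Associated P R)
    (hP : P.leadingCoeff.Monic) (hR : R.leadingCoeff.Monic) : P = R := by
  obtain ⟨u, rfl⟩ := h
  obtain ⟨c, hc, hcu⟩ := Polynomial.isUnit_iff.mp u.isUnit
  obtain ⟨a, ha, rfl⟩ := Polynomial.isUnit_iff.mp hc
  rw [← hcu, leadingCoeff_mul, leadingCoeff_C, Monic, leadingCoeff_mul, hP.leadingCoeff, one_mul,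
    leadingCoeff_C] at hR
  rw [← hcu, hR, C_1, C_1, mul_one]

theorem isMinPolyOf_unique (hφ : Function.Injective (ringHomTC Fq)) {α : AC Fq} {P R : Fq[X][X]}
    (hP : IsMinPolyOf Fq α P) (hR : IsMinPolyOf Fq α R) : P = R := by
  refine eq_of_associated_of_monic (associated_of_common_root hφ (α := α) hP.2.1 hR.2.1
    hP.1.ne' ?_ ?_) hP.2.2.2.1 hR.2.2.2.1
  · rw [← evalPC_eq_eval_map]; exact hP.2.2.2.2
  · rw [← evalPC_eq_eval_map]; exact hR.2.2.2.2

theorem degT_eq (hφ : Function.Injective (ringHomTC Fq)) {α : AC Fq} {P : Fq[X][X]}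
    (hP : IsMinPolyOf Fq α P) : degT Fq α = P.natDegree := by
  have h : IsAlgT Fq α := ⟨P, hP⟩
  rw [degT, dif_pos h, isMinPolyOf_unique hφ h.choose_spec hP]

theorem heightT_eq (hφ : Function.Injective (ringHomTC Fq)) (q : ℕ) {α : AC Fq} {P : Fq[X][X]}
    (hP : IsMinPolyOf Fq α P) : heightT Fq q α = heightP Fq q P := by
  have h : IsAlgT Fq α := ⟨P, hP⟩
  rw [heightT, dif_pos h, isMinPolyOf_unique hφ h.choose_spec hP]

theorem finite_isMinPolyOf (hφ : Function.Injective (ringHomTC Fq)) (P : Fq[X][X]) :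
    {α : AC Fq | IsMinPolyOf Fq α P}.Finite := by
  by_cases hP : P = 0
  · convert Set.finite_empty (α := AC Fq)
    ext α
    simp [IsMinPolyOf, hP]
  refine (Polynomial.finite_setOfPred_isRoot (p := P.map (ringHomTC Fq))
    ((Polynomial.map_ne_zero_iff hφ).mpr hP)).subset ?_
  intro α hα
  change (P.map (ringHomTC Fq)).eval α = 0
  rw [← evalPC_eq_eval_map]
  exact hα.2.2.2.2

end MinimalPolynomials

section UpperBound

variable {Fq : Type} [Field Fq] {q : ℕ} {v : AbsoluteValue (AC Fq) ℝ}

theorem absL_evalP (hL : ∀ x, v (iota Fq x) = absL Fq q x) (ξ : LaurentSeries Fq) (P : Fq[X][X]) :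
    absL Fq q (evalP Fq ξ P) = v ((P.map (ringHomTC Fq)).eval (iota Fq ξ)) := by
  rw [← hL, iota_evalP]

theorem le_rpow_of_rpow_inv_le {M H e : ℝ} (hM : 0 ≤ M) (he : 0 < e) (h : M ^ e⁻¹ ≤ H) :
    M ≤ H ^ e := by
  calc M = (M ^ e⁻¹) ^ e := by rw [← Real.rpow_mul hM, inv_mul_cancel₀ he.ne', Real.rpow_one]
    _ ≤ H ^ e := Real.rpow_le_rpow (Real.rpow_nonneg hM _) h he.le

theorem infinite_of_lt_of_infinite_star [Finite Fq] (hq : 1 < q) (hna : IsNonarchimedean v)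
    (hC : ∀ x, v x = absC Fq q x) (hL : ∀ x, v (iota Fq x) = absL Fq q x) (n : ℕ)
    (ξ : LaurentSeries Fq) {w r : ℝ} (hrw : r < w)
    (hinf : {α : AC Fq | IsAlgT Fq α ∧ degT Fq α ≤ n ∧ 0 < absC Fq q (iota Fq ξ - α) ∧
      absC Fq q (iota Fq ξ - α) ≤ heightT Fq q α ^ (-w - 1)}.Infinite) :
    {P : Fq[X][X] | P.natDegree ≤ n ∧ 0 < absL Fq q (evalP Fq ξ P) ∧
      absL Fq q (evalP Fq ξ P) ≤ heightP Fq q P ^ (-r)}.Infinite := by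
  have hφ := ringHomTC_injective hq hna hL
  intro hfin
  set M : ℝ := max 1 (v (iota Fq ξ)) ^ n
  have hM : 0 ≤ M := pow_nonneg (zero_le_one.trans (le_max_left _ _)) _
  have hsmall := finite_heightP_le (Fq := Fq) hq n (M ^ (w - r)⁻¹)
  have hroot : {P : Fq[X][X] | IsMinPolyOf Fq (iota Fq ξ) P}.Finite :=
    Set.Subsingleton.finite fun P hP R hR => isMinPolyOf_unique hφ hP hR
  refine hinf (((hfin.union (hsmall.union hroot)).biUnion
    fun P _ => finite_isMinPolyOf hφ P).subset ?_)
  rintro α ⟨⟨P, hP⟩, hdeg, -, hle⟩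
  rw [degT_eq hφ hP] at hdeg
  rw [heightT_eq hφ q hP, ← hC] at hle
  refine Set.mem_biUnion (x := P) ?_ hP
  by_cases hξ : (P.map (ringHomTC Fq)).eval (iota Fq ξ) = 0
  · exact Or.inr (Or.inr ⟨hP.1, hP.2.1, hP.2.2.1, hP.2.2.2.1, by rwa [evalPC_eq_eval_map]⟩)
  rcases le_or_gt (heightP Fq q P) (M ^ (w - r)⁻¹) with hB | hB
  · exact Or.inr (Or.inl ⟨hdeg, hB⟩)
  refine Or.inl ⟨hdeg, ?_⟩
  rw [absL_evalP hL]
  refine ⟨v.pos hξ, ?_⟩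
  have hroot : (P.map (ringHomTC Fq)).eval α = 0 := by
    rw [← evalPC_eq_eval_map]; exact hP.2.2.2.2
  have hH : 0 < heightP Fq q P :=
    zero_lt_one.trans_le (one_le_heightP hq hP.2.1.ne_zero)
  have h1 := abv_eval_le_sub_root hna hroot (iota Fq ξ) (natDegree_map_le.trans hdeg)
  rw [← heightP_eq_gaussNorm hq hna hL] at h1
  calc _ ≤ v (iota Fq ξ - α) * (heightP Fq q P * M) := h1
    _ ≤ heightP Fq q P ^ (-w - 1) * (heightP Fq q P * heightP Fq q P ^ (w - r)) := by
        have := le_rpow_of_rpow_inv_le hM (sub_pos.mpr hrw) hB.le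
        gcongr
    _ = heightP Fq q P ^ (-r) := by
        nth_rewrite 2 [← Real.rpow_one (heightP Fq q P)]
        rw [← Real.rpow_add hH, ← Real.rpow_add hH]
        congr 1
        ring

theorem wnStar_le_wn [Finite Fq] (hq : 1 < q) (n : ℕ) (ξ : LaurentSeries Fq) :
    wnStar Fq q n ξ ≤ wn Fq q n ξ := by
  obtain ⟨v, hna, hC, hL⟩ := exists_absoluteValue Fq q hq
  refine sSup_le ?_
  rintro _ ⟨w, hw, rfl⟩
  refine le_of_forall_lt_imp_le_of_dense fun a ha => ?_
  obtain ⟨r, har, hrw⟩ := EReal.lt_iff_exists_real_btwn.mp ha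
  refine har.le.trans (le_sSup ⟨r, ?_, rfl⟩)
  exact infinite_of_lt_of_infinite_star hq hna hC hL n ξ (EReal.coe_lt_coe_iff.mp hrw) hw

end UpperBound

section Separable

variable {A L : Type*} [CommRing A] [Field L] {φ : A →+* L}

theorem discr_map_of_injective (hφ : Function.Injective φ) {Q : A[X]} (hQ : 0 < Q.natDegree) :
    (Q.map φ).discr = φ Q.discr := by
  have hdeg : (Q.map φ).natDegree = Q.natDegree := natDegree_map_eq_of_injective hφ Q
  have h1 := resultant_deriv (f := Q) (natDegree_pos_iff_degree_pos.mp hQ)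
  have h2 := resultant_deriv (f := Q.map φ) (natDegree_pos_iff_degree_pos.mp (hdeg ▸ hQ))
  have h3 := congrArg φ h1
  rw [← resultant_map_map, ← derivative_map] at h3
  rw [hdeg, h3, leadingCoeff_map_of_injective hφ] at h2
  simp only [map_mul, map_pow, map_neg, map_one] at h2
  have hl : φ Q.leadingCoeff ≠ 0 := by
    rw [Ne, map_eq_zero_iff φ hφ, leadingCoeff_eq_zero]
    rintro rfl
    simp at hQ
  have hs : ((-1 : L) ^ (Q.natDegree * (Q.natDegree - 1) / 2)) ≠ 0 := by simp
  exact (mul_left_cancel₀ (mul_ne_zero hs hl) h2).symm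

/-- A primitive irreducible polynomial is the expansion of one that becomes separable. -/
theorem exists_separable_expand [IsDomain A] [NormalizedGCDMonoid A] (p : ℕ) [hp : Fact p.Prime]
    [CharP A p] (hφ : Function.Injective φ) {R : A[X]} (hR : Irreducible R) (hdeg : R.natDegree ≠ 0) :
    ∃ (j : ℕ) (Q : A[X]), expand A (p ^ j) Q = R ∧ (Q.map φ).Separable := by
  let ψ : FractionRing A →+* L := IsFractionRing.lift hφ
  have hψ : ψ.comp (algebraMap A (FractionRing A)) = φ := by
    ext x; exact IsFractionRing.lift_algebraMap hφ x
  have hinj : Function.Injective (algebraMap A (FractionRing A)) :=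
    IsFractionRing.injective A (FractionRing A)
  have : CharP (FractionRing A) p := charP_of_injective_ringHom hinj p
  have : ExpChar (FractionRing A) p := ExpChar.prime hp.out
  have hR' := ((hR.isPrimitive hdeg).irreducible_iff_irreducible_map_fraction_map
    (K := FractionRing A)).mp hR
  obtain ⟨g, hg, j, hj⟩ := hR'.hasSeparableContraction p
  have hpj : p ^ j ≠ 0 := pow_ne_zero _ hp.out.ne_zero
  have hQ : (R.contract (p ^ j)).map (algebraMap A (FractionRing A)) = g := by
    rw [map_contract hpj, ← hj, contract_expand _ hpj]
  refine ⟨j, R.contract (p ^ j), ?_, ?_⟩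
  · apply map_injective _ hinj
    rw [map_expand, hQ, hj]
  · rw [← hψ, ← Polynomial.map_map, hQ]
    exact hg.map

end Separable

section LowerBound

variable {Fq : Type} [Field Fq] {q : ℕ} {v : AbsoluteValue (AC Fq) ℝ}

theorem charP_AC (p : ℕ) [CharP Fq p] : CharP (AC Fq) p :=
  charP_of_injective_ringHom
    ((iota Fq).comp (HahnSeries.C : Fq →+* LaurentSeries Fq)).injective p

/-- A root of an irreducible `R` close to `ξ`, in terms of the size of `R(ξ)`. -/
theorem exists_root_close (p : ℕ) [hp : Fact p.Prime] [CharP Fq p] (hq : 1 < q)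
    (hna : IsNonarchimedean v) (hL : ∀ x, v (iota Fq x) = absL Fq q x) {n k : ℕ}
    (hk' : n < p ^ (k + 1)) (x : AC Fq) {R : Fq[X][X]} (hR : Irreducible R)
    (hpos : 0 < R.natDegree) (hdeg : R.natDegree ≤ n) {w : ℝ} (hw : -1 < w)
    (hH : 1 < heightP Fq q R)
    (hle : v ((R.map (ringHomTC Fq)).eval x) ≤ heightP Fq q R ^ (-w)) :
    ∃ α, (R.map (ringHomTC Fq)).eval α = 0 ∧
      v (x - α) ≤ max 1 (v x) * heightP Fq q R ^ (n - (w + 2) / p ^ k) := by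
  have := charP_AC (Fq := Fq) p
  have hφ := ringHomTC_injective hq hna hL
  obtain ⟨j, Q, rfl, hsep⟩ := exists_separable_expand (φ := ringHomTC Fq) p hφ hR hpos.ne'
  have hf0 : 0 < p ^ j := pow_pos hp.out.pos j
  generalize hHdef : heightP Fq q (expand Fq[X] (p ^ j) Q) = H at *
  rw [heightP_expand _ hf0] at hHdef
  rw [natDegree_expand] at hpos hdeg
  have hQpos : 0 < Q.natDegree := Nat.pos_of_mul_pos_right hpos
  have hjk : j ≤ k := by
    have h1 : p ^ j < p ^ (k + 1) :=
      ((Nat.le_mul_of_pos_left _ hQpos).trans hdeg).trans_lt hk'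
    exact Nat.lt_succ_iff.mp ((Nat.pow_lt_pow_iff_right hp.out.one_lt).mp h1)
  set Qm := Q.map (ringHomTC Fq) with hQm
  have hQmdeg : Qm.natDegree = Q.natDegree := natDegree_map_eq_of_injective hφ Q
  have hQm0 : Qm ≠ 0 := by
    intro h
    rw [h, natDegree_zero] at hQmdeg
    omega
  have hsplit : Qm.Splits := IsAlgClosed.splits Qm
  have hdisc : 1 ≤ v Qm.discr := by
    have h0 := discr_ne_zero_of_separable hsplit (hQmdeg ▸ hQpos) hsep
    rw [hQm, discr_map_of_injective hφ hQpos] at h0 ⊢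
    exact one_le_abv_ringHomTC hq hna hL fun h => h0 (by rw [h, map_zero])
  rw [map_expand, expand_eval] at hle
  have hgn : Qm.gaussNorm v 1 = H := by rw [← hHdef, heightP_eq_gaussNorm hq hna hL]
  have hH0 : 0 < H := zero_lt_one.trans hH
  have hsmall : v (Qm.eval (x ^ p ^ j)) < Qm.gaussNorm v 1 := by
    rw [hgn]
    refine hle.trans_lt ?_
    calc H ^ (-w) < H ^ (1 : ℝ) := Real.rpow_lt_rpow_of_exponent_lt hH (by linarith)
      _ = H := Real.rpow_one H
  have hne : Qm.roots.toFinset.Nonempty := by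
    obtain ⟨b, hb⟩ := IsAlgClosed.exists_root Qm
      (natDegree_pos_iff_degree_pos.mp (hQmdeg ▸ hQpos)).ne'
    exact ⟨b, by simp [hQm0, hb.eq_zero]⟩
  obtain ⟨b, hb, hclose⟩ := Finset.exists_min_image Qm.roots.toFinset
    (fun b => v (x ^ p ^ j - b)) hne
  rw [Multiset.mem_toFinset, mem_roots hQm0] at hb
  have key := abv_sub_closest_root_le hna hsplit (hQmdeg ▸ hQpos) hdisc hb
    (fun c hc => hclose c (Multiset.mem_toFinset.mpr hc)) hsmall
  obtain ⟨α, rfl⟩ := IsAlgClosed.exists_pow_nat_eq b hf0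
  refine ⟨α, ?_, ?_⟩
  · rw [map_expand, expand_eval]
    exact hb
  rw [hgn, hQmdeg, ← sub_pow_char_pow, map_pow, map_pow] at key
  have hmax : max 1 (v x ^ p ^ j) ≤ max 1 (v x) ^ p ^ j :=
    max_le (one_le_pow₀ (le_max_left _ _))
      (pow_le_pow_left₀ (v.nonneg _) (le_max_right _ _) _)
  have hpow : v (x - α) ^ p ^ j ≤
      max 1 (v x) ^ p ^ j * H ^ (-w + Q.natDegree - 2) := by
    have h1 : v (x - α) ^ p ^ j * H ^ 2 ≤
        (max 1 (v x) ^ p ^ j * H ^ (-w + Q.natDegree - 2)) * H ^ 2 := by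
      calc _ ≤ _ := key
        _ ≤ H ^ (-w) * H ^ Q.natDegree * max 1 (v x) ^ p ^ j := by gcongr
        _ = _ := by
          rw [Real.rpow_sub hH0, Real.rpow_add hH0, Real.rpow_natCast]
          norm_cast
          field_simp
    exact le_of_mul_le_mul_right h1 (by positivity)
  have hpR : (0 : ℝ) < p := by exact_mod_cast hp.out.pos
  have hp1 : (1 : ℝ) ≤ p := by exact_mod_cast hp.out.one_lt.le
  refine le_of_pow_le_pow_left₀ hf0.ne' (by positivity) (hpow.trans ?_)
  rw [mul_pow, ← Real.rpow_mul_natCast hH0.le]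
  refine mul_le_mul_of_nonneg_left ?_ (by positivity)
  refine Real.rpow_le_rpow_of_exponent_le hH.le ?_
  push_cast
  have e1 : (w + 2) / p ^ k * p ^ j ≤ w + 2 := by
    rw [div_mul_eq_mul_div, div_le_iff₀ (by positivity)]
    exact mul_le_mul_of_nonneg_left (pow_le_pow_right₀ hp1 hjk) (by linarith)
  have e2 : (Q.natDegree : ℝ) ≤ n * p ^ j := by
    have : Q.natDegree ≤ n * p ^ j :=
      ((Nat.le_mul_of_pos_right _ hf0).trans hdeg).trans (Nat.le_mul_of_pos_right _ hf0)
    exact_mod_cast this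
  linarith

end LowerBound

section Irreducible

variable {Fq : Type} [Field Fq] {q : ℕ} {v : AbsoluteValue (AC Fq) ℝ}

theorem one_le_abv_mul_heightP_C (hq : 1 < q) (hna : IsNonarchimedean v)
    (hL : ∀ x, v (iota Fq x) = absL Fq q x) {w : ℝ} (hw : -1 < w) {c : Fq[X]} (hc : c ≠ 0) :
    1 ≤ v (ringHomTC Fq c) * heightP Fq q (C c) ^ w := by
  have h1 := one_le_abv_ringHomTC hq hna hL hc
  rw [heightP_C c hc, ← abv_ringHomTC hq hna hL hc]
  have h0 : 0 < v (ringHomTC Fq c) := zero_lt_one.trans_le h1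
  nth_rewrite 1 [← Real.rpow_one (v (ringHomTC Fq c))]
  rw [← Real.rpow_add h0]
  exact Real.one_le_rpow h1 (by linarith)

theorem heightP_C_C_mul (hq : 1 < q) (hna : IsNonarchimedean v)
    (hL : ∀ x, v (iota Fq x) = absL Fq q x) {a : Fq} (ha : a ≠ 0) (P : Fq[X][X]) :
    heightP Fq q (C (C a) * P) = heightP Fq q P := by
  rw [heightP_mul hq hna hL, heightP_C _ (by simpa using ha), natDegree_C, pow_zero, one_mul]

/-- A lower bound for `|R(x)| H(R)^w` on irreducible polynomials gives one on all polynomials. -/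
theorem pow_natDegree_le_abv_mul_heightP (hq : 1 < q) (hna : IsNonarchimedean v)
    (hL : ∀ x, v (iota Fq x) = absL Fq q x) {w : ℝ} (hw : -1 < w) {n : ℕ} {x : AC Fq} {m : ℝ}
    (hm : 0 < m) (hm1 : m ≤ 1)
    (h : ∀ R : Fq[X][X], Irreducible R → 0 < R.natDegree → R.natDegree ≤ n →
      R.leadingCoeff.Monic → (R.map (ringHomTC Fq)).eval x ≠ 0 →
      m ≤ v ((R.map (ringHomTC Fq)).eval x) * heightP Fq q R ^ w) (P : Fq[X][X]) :
    P.natDegree ≤ n → (P.map (ringHomTC Fq)).eval x ≠ 0 →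
      m ^ P.natDegree ≤ v ((P.map (ringHomTC Fq)).eval x) * heightP Fq q P ^ w := by
  have hconst : ∀ c : Fq[X], ((C c : Fq[X][X]).map (ringHomTC Fq)).eval x ≠ 0 →
      1 ≤ v (((C c : Fq[X][X]).map (ringHomTC Fq)).eval x) * heightP Fq q (C c) ^ w := by
    intro c hc
    rw [map_C, eval_C] at hc ⊢
    exact one_le_abv_mul_heightP_C hq hna hL hw fun h0 => hc (by rw [h0, map_zero])
  induction P using WfDvdMonoid.induction_on_irreducible with
  | zero => intro _ h0; simp at h0
  | unit u hu =>
    intro _ h0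
    obtain ⟨c, -, rfl⟩ := Polynomial.isUnit_iff.mp hu
    rw [natDegree_C, pow_zero]
    exact hconst c h0
  | mul a i ha hi ih =>
    intro hdeg h0
    rw [natDegree_mul hi.ne_zero ha] at hdeg ⊢
    rw [Polynomial.map_mul, eval_mul] at h0 ⊢
    have hih := ih (by omega) (right_ne_zero_of_mul h0)
    have hi0 := left_ne_zero_of_mul h0
    rw [heightP_mul hq hna hL, map_mul, Real.mul_rpow
      (zero_le_one.trans (one_le_heightP hq hi.ne_zero))
      (zero_le_one.trans (one_le_heightP hq ha)), mul_mul_mul_comm, pow_add]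
    have hfac : m ^ i.natDegree ≤ v ((i.map (ringHomTC Fq)).eval x) * heightP Fq q i ^ w := by
      rcases Nat.eq_zero_or_pos i.natDegree with hd | hd
      · obtain ⟨c, rfl⟩ : ∃ c, i = C c := ⟨_, eq_C_of_natDegree_eq_zero hd⟩
        rw [natDegree_C, pow_zero]
        exact hconst c hi0
      · refine (pow_le_of_le_one hm.le hm1 hd.ne').trans ?_
        set b : Fq := i.leadingCoeff.leadingCoeff⁻¹
        have hb : b ≠ 0 := by simpa [b] using hi.ne_zero
        have hunit : IsUnit (C (C b) : Fq[X][X]) := by simpa using hb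
        have hnd : (C (C b) * i).natDegree = i.natDegree :=
          natDegree_C_mul (by simpa using hb)
        have hev : v (((C (C b) * i).map (ringHomTC Fq)).eval x) =
            v ((i.map (ringHomTC Fq)).eval x) := by
          rw [Polynomial.map_mul, eval_mul, map_C, eval_C, map_mul, abv_ringHomTC_C hL hb, one_mul]
        have := h (C (C b) * i)
          ((irreducible_isUnit_mul hunit).mpr hi)
          (by omega) (by omega) ?_ ?_
        · rwa [hev, heightP_C_C_mul hq hna hL hb] at this
        · rw [Monic, leadingCoeff_mul, leadingCoeff_C, leadingCoeff_mul, leadingCoeff_C]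
          exact inv_mul_cancel₀ (by simpa using hi.ne_zero)
        · rwa [Ne, ← v.eq_zero, hev, v.eq_zero]
    have hm0 := hm.le
    gcongr
    exact (pow_nonneg hm0 _).trans hfac

/-- Small values of polynomials force small values of irreducible polynomials. -/
theorem infinite_irreducible_small [Finite Fq] (hq : 1 < q) (hna : IsNonarchimedean v)
    (hL : ∀ x, v (iota Fq x) = absL Fq q x) (n : ℕ) (x : AC Fq) {w w' : ℝ} (hw : -1 < w)
    (hww' : w < w')
    (hinf : {P : Fq[X][X] | P.natDegree ≤ n ∧ 0 < v ((P.map (ringHomTC Fq)).eval x) ∧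
      v ((P.map (ringHomTC Fq)).eval x) ≤ heightP Fq q P ^ (-w')}.Infinite) :
    {R : Fq[X][X] | Irreducible R ∧ 0 < R.natDegree ∧ R.natDegree ≤ n ∧ R.leadingCoeff.Monic ∧
      (R.map (ringHomTC Fq)).eval x ≠ 0 ∧
      v ((R.map (ringHomTC Fq)).eval x) ≤ heightP Fq q R ^ (-w)}.Infinite := by
  intro hfin
  set S := {R : Fq[X][X] | Irreducible R ∧ 0 < R.natDegree ∧ R.natDegree ≤ n ∧
      R.leadingCoeff.Monic ∧ (R.map (ringHomTC Fq)).eval x ≠ 0 ∧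
      v ((R.map (ringHomTC Fq)).eval x) ≤ heightP Fq q R ^ (-w)} with hS
  let ρ : Fq[X][X] → ℝ := fun R => v ((R.map (ringHomTC Fq)).eval x) * heightP Fq q R ^ w
  have hHpos : ∀ {R : Fq[X][X]}, R ≠ 0 → 0 < heightP Fq q R := fun h =>
    zero_lt_one.trans_le (one_le_heightP hq h)
  obtain ⟨m, hmem, hmin⟩ := Set.exists_min_image (insert 1 (ρ '' S)) id
    ((hfin.image ρ).insert 1) ⟨1, Set.mem_insert _ _⟩
  have hm1 : m ≤ 1 := hmin 1 (Set.mem_insert _ _)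
  have hm : 0 < m := by
    rcases hmem with rfl | ⟨R, hR, rfl⟩
    · exact zero_lt_one
    · exact mul_pos (v.pos hR.2.2.2.2.1) (Real.rpow_pos_of_pos (hHpos hR.1.ne_zero) _)
  have hall := pow_natDegree_le_abv_mul_heightP (n := n) (x := x) hq hna hL hw hm hm1 (by
    intro R hR hpos hdeg hmon h0
    by_cases hle : v ((R.map (ringHomTC Fq)).eval x) ≤ heightP Fq q R ^ (-w)
    · exact hmin _ (Or.inr ⟨R, ⟨hR, hpos, hdeg, hmon, h0, hle⟩, rfl⟩)
    · refine hm1.trans ?_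
      have hHw := Real.rpow_pos_of_pos (hHpos hR.ne_zero) w
      calc (1 : ℝ) = heightP Fq q R ^ (-w) * heightP Fq q R ^ w := by
            rw [Real.rpow_neg (hHpos hR.ne_zero).le, inv_mul_cancel₀ hHw.ne']
        _ ≤ _ := mul_le_mul_of_nonneg_right (not_le.mp hle).le hHw.le)
  refine hinf ((finite_heightP_le hq n (((m ^ n)⁻¹) ^ (w' - w)⁻¹)).subset ?_)
  rintro P ⟨hdeg, hpos, hle⟩
  refine ⟨hdeg, ?_⟩
  have hP0 : P ≠ 0 := by rintro rfl; simp at hpos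
  have hH := hHpos hP0
  have h1 := hall P hdeg (v.pos_iff.mp hpos)
  have h2 : m ^ n ≤ heightP Fq q P ^ (-w') * heightP Fq q P ^ w :=
    ((pow_le_pow_of_le_one hm.le hm1 hdeg).trans h1).trans
      (mul_le_mul_of_nonneg_right hle (Real.rpow_nonneg hH.le _))
  rw [← Real.rpow_add hH, show -w' + w = -(w' - w) by ring, Real.rpow_neg hH.le] at h2
  have h3 : heightP Fq q P ^ (w' - w) ≤ (m ^ n)⁻¹ :=
    (le_inv_comm₀ (pow_pos hm n) (Real.rpow_pos_of_pos hH _)).mp h2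
  calc heightP Fq q P = (heightP Fq q P ^ (w' - w)) ^ (w' - w)⁻¹ := by
        rw [← Real.rpow_mul hH.le, mul_inv_cancel₀ (sub_pos.mpr hww').ne', Real.rpow_one]
    _ ≤ _ := Real.rpow_le_rpow (Real.rpow_nonneg hH.le _) h3 (inv_nonneg.mpr (by linarith))

theorem infinite_star_of_infinite [Finite Fq] (p : ℕ) [Fact p.Prime] [CharP Fq p] (hq : 1 < q)
    (hna : IsNonarchimedean v) (hC : ∀ x, v x = absC Fq q x)
    (hL : ∀ x, v (iota Fq x) = absL Fq q x) {n k : ℕ} (hk' : n < p ^ (k + 1))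
    (ξ : LaurentSeries Fq) {w w' s : ℝ} (hw : -1 < w) (hww' : w < w')
    (hs : s < (w + 2) / p ^ k - n - 1)
    (hinf : {P : Fq[X][X] | P.natDegree ≤ n ∧ 0 < absL Fq q (evalP Fq ξ P) ∧
      absL Fq q (evalP Fq ξ P) ≤ heightP Fq q P ^ (-w')}.Infinite) :
    {α : AC Fq | IsAlgT Fq α ∧ degT Fq α ≤ n ∧ 0 < absC Fq q (iota Fq ξ - α) ∧
      absC Fq q (iota Fq ξ - α) ≤ heightT Fq q α ^ (-s - 1)}.Infinite := by
  have hφ := ringHomTC_injective hq hna hL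
  simp only [absL_evalP hL] at hinf
  have hirr := infinite_irreducible_small hq hna hL n (iota Fq ξ) hw hww' hinf
  set e : ℝ := (w + 2) / p ^ k - n - 1 - s with he
  have he0 : 0 < e := sub_pos.mpr hs
  set M : ℝ := max 1 (v (iota Fq ξ))
  have hM : 0 ≤ M := zero_le_one.trans (le_max_left _ _)
  have hlarge := hirr.sdiff (finite_heightP_le hq n (max 1 (M ^ e⁻¹)))
  have hex : ∀ R ∈ {R : Fq[X][X] | Irreducible R ∧ 0 < R.natDegree ∧ R.natDegree ≤ n ∧
      R.leadingCoeff.Monic ∧ (R.map (ringHomTC Fq)).eval (iota Fq ξ) ≠ 0 ∧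
      v ((R.map (ringHomTC Fq)).eval (iota Fq ξ)) ≤ heightP Fq q R ^ (-w)} \
      {P : Fq[X][X] | P.natDegree ≤ n ∧ heightP Fq q P ≤ max 1 (M ^ e⁻¹)},
      ∃ α, IsMinPolyOf Fq α R ∧ iota Fq ξ - α ≠ 0 ∧
        v (iota Fq ξ - α) ≤ heightP Fq q R ^ (-s - 1) := by
    rintro R ⟨⟨hR, hpos, hdeg, hmon, h0, hle⟩, hnot⟩
    have hB : max 1 (M ^ e⁻¹) < heightP Fq q R := not_le.mp fun h => hnot ⟨hdeg, h⟩
    have hH : 1 < heightP Fq q R := (le_max_left _ _).trans_lt hB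
    have hH0 : 0 < heightP Fq q R := zero_lt_one.trans hH
    obtain ⟨α, hα, hclose⟩ :=
      exists_root_close p hq hna hL hk' (iota Fq ξ) hR hpos hdeg hw hH hle
    refine ⟨α, ⟨hpos, hR, hR.isPrimitive hpos.ne', hmon, by rwa [evalPC_eq_eval_map]⟩, ?_, ?_⟩
    · intro h
      rw [sub_eq_zero.mp h] at h0
      exact h0 hα
    · calc _ ≤ M * heightP Fq q R ^ (n - (w + 2) / p ^ k) := hclose
        _ ≤ heightP Fq q R ^ e * heightP Fq q R ^ (n - (w + 2) / p ^ k) := by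
          have := le_rpow_of_rpow_inv_le hM he0 ((le_max_right _ _).trans hB.le)
          gcongr
        _ = _ := by
          rw [← Real.rpow_add hH0]
          congr 1
          rw [he]
          ring
  choose! α hα using hex
  refine Set.infinite_of_injOn_mapsTo (f := α) ?_ ?_ hlarge
  · intro R hR R' hR' heq
    exact isMinPolyOf_unique hφ (hα R hR).1 (heq ▸ (hα R' hR').1)
  · intro R hR
    obtain ⟨hmin, hne, hle⟩ := hα R hR
    refine ⟨⟨R, hmin⟩, (degT_eq hφ hmin).trans_le hR.1.2.2.1, ?_, ?_⟩
    · rw [← hC]; exact v.pos hne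
    · rw [← hC, heightT_eq hφ q hmin]; exact hle

end Irreducible

section Comparison

variable {Fq : Type} [Field Fq] {q : ℕ} {v : AbsoluteValue (AC Fq) ℝ}

theorem isMinPolyOf_inv_X_pow (hφ : Function.Injective (ringHomTC Fq)) (j : ℕ) :
    IsMinPolyOf Fq ((ringHomTC Fq X)⁻¹ ^ j) (C (X ^ j) * X + C (-1)) := by
  have hX : (X : Fq[X]) ^ j ≠ 0 := pow_ne_zero _ X_ne_zero
  have hirr : Irreducible (C ((X : Fq[X]) ^ j) * X + C (-1)) :=
    irreducible_C_mul_X_add_C hX (isCoprime_one_right.neg_right).isRelPrime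
  have hdeg : (C ((X : Fq[X]) ^ j) * X + C (-1)).natDegree = 1 := natDegree_linear hX
  refine ⟨by omega, hirr, hirr.isPrimitive (by omega), ?_, ?_⟩
  · rw [leadingCoeff_linear hX]
    exact monic_X_pow j
  · have hX' : ringHomTC Fq X ≠ 0 := by
      rw [Ne, map_eq_zero_iff _ hφ]
      exact X_ne_zero
    rw [evalPC_eq_eval_map]
    simp [hX']

theorem heightP_X_pow_mul_X_sub_one (q j : ℕ) (hq : 1 < q) :
    (q : ℝ) ^ j ≤ heightP Fq q (C (X ^ j) * X + C (-1)) := by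
  have hc : (C ((X : Fq[X]) ^ j) * X + C (-1)).coeff 1 = X ^ j := by
    rw [coeff_add, coeff_C_mul, coeff_X_one, mul_one, coeff_C_of_ne_zero one_ne_zero, add_zero]
  have h1 : 1 ∈ (C ((X : Fq[X]) ^ j) * X + C (-1)).support := by
    rw [mem_support_iff, hc]
    exact pow_ne_zero _ X_ne_zero
  have h0 : C ((X : Fq[X]) ^ j) * X + C (-1) ≠ 0 := by
    intro h
    rw [h] at h1
    simp at h1
  rw [heightP, if_neg h0]
  refine pow_le_pow_right₀ (by exact_mod_cast hq.le) ?_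
  have := Finset.le_sup
    (f := fun i => ((C ((X : Fq[X]) ^ j) * X + C (-1)).coeff i).natDegree) h1
  simpa only [hc, natDegree_X_pow] using this

theorem infinite_star_of_lt_neg_one (hq : 1 < q) (hna : IsNonarchimedean v)
    (hC : ∀ x, v x = absC Fq q x) (hL : ∀ x, v (iota Fq x) = absL Fq q x) {n : ℕ} (hn : 1 ≤ n)
    (ξ : LaurentSeries Fq) {s : ℝ} (hs : s < -1) :
    {α : AC Fq | IsAlgT Fq α ∧ degT Fq α ≤ n ∧ 0 < absC Fq q (iota Fq ξ - α) ∧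
      absC Fq q (iota Fq ξ - α) ≤ heightT Fq q α ^ (-s - 1)}.Infinite := by
  have hφ := ringHomTC_injective hq hna hL
  have hq1 : (1 : ℝ) < q := by exact_mod_cast hq
  have hq0 : (0 : ℝ) < q := zero_lt_one.trans hq1
  have hvj : ∀ j : ℕ, v ((ringHomTC Fq X)⁻¹ ^ j) = ((q : ℝ) ^ j)⁻¹ := fun j => by
    rw [map_pow, map_inv₀, abv_ringHomTC_X hL, inv_pow]
  set M : ℝ := max 1 (v (iota Fq ξ))
  have hM : 0 ≤ M := zero_le_one.trans (le_max_left _ _)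
  obtain ⟨J, hJ⟩ := pow_unbounded_of_one_lt (M ^ (-s - 1)⁻¹) hq1
  have hinj : Function.Injective fun j : ℕ => (ringHomTC Fq X)⁻¹ ^ j := by
    intro i j h
    have := congrArg v h
    simp only [hvj, inv_inj] at this
    exact pow_right_injective₀ hq0 hq1.ne' this
  have hfin : {j : ℕ | (ringHomTC Fq X)⁻¹ ^ j = iota Fq ξ}.Finite :=
    Set.Subsingleton.finite fun i hi j hj => hinj (hi.trans hj.symm)
  refine Set.infinite_of_injOn_mapsTo (f := fun j : ℕ => (ringHomTC Fq X)⁻¹ ^ j) hinj.injOn ?_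
    ((Set.Ici_infinite J).sdiff hfin)
  rintro j ⟨hj, hne⟩
  have hmin := isMinPolyOf_inv_X_pow hφ j
  refine ⟨⟨_, hmin⟩, ?_, ?_, ?_⟩
  · rw [degT_eq hφ hmin, natDegree_linear (pow_ne_zero _ X_ne_zero)]
    exact hn
  · rw [← hC]
    exact v.pos (sub_ne_zero.mpr (Ne.symm hne))
  · rw [← hC, heightT_eq hφ q hmin]
    have h1 : v (iota Fq ξ - (ringHomTC Fq X)⁻¹ ^ j) ≤ M := by
      rw [sub_eq_add_neg]
      refine (hna _ _).trans ?_
      rw [v.map_neg, hvj, max_comm]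
      exact max_le_max (inv_le_one_of_one_le₀ (one_le_pow₀ hq1.le)) le_rfl
    refine h1.trans (le_rpow_of_rpow_inv_le hM (by linarith) (hJ.le.trans ?_))
    exact (pow_le_pow_right₀ hq1.le hj).trans (heightP_X_pow_mul_X_sub_one q j hq)

theorem EReal.coe_le_of_forall_coe_lt {a : ℝ} {b : EReal} (h : ∀ s : ℝ, s < a → (s : EReal) ≤ b) :
    (a : EReal) ≤ b := by
  refine le_of_forall_lt_imp_le_of_dense fun c hc => ?_
  obtain ⟨r, hcr, hra⟩ := EReal.lt_iff_exists_real_btwn.mp hc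
  exact hcr.le.trans (h r (EReal.coe_lt_coe_iff.mp hra))

theorem neg_one_le_wnStar (hq : 1 < q) {n : ℕ} (hn : 1 ≤ n) (ξ : LaurentSeries Fq) :
    ((-1 : ℝ) : EReal) ≤ wnStar Fq q n ξ := by
  obtain ⟨v, hna, hC, hL⟩ := exists_absoluteValue Fq q hq
  exact EReal.coe_le_of_forall_coe_lt fun s hs =>
    le_sSup ⟨s, infinite_star_of_lt_neg_one hq hna hC hL hn ξ hs, rfl⟩

theorem le_wnStar_of_lt_wn [Finite Fq] (p : ℕ) [Fact p.Prime] [CharP Fq p] (hq : 1 < q)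
    {n k : ℕ} (hk' : n < p ^ (k + 1)) (ξ : LaurentSeries Fq) {w : ℝ} (hw : -1 < w)
    (h : (w : EReal) < wn Fq q n ξ) :
    (((w + 2) / p ^ k - n - 1 : ℝ) : EReal) ≤ wnStar Fq q n ξ := by
  obtain ⟨v, hna, hC, hL⟩ := exists_absoluteValue Fq q hq
  obtain ⟨_, ⟨w', hw', rfl⟩, hlt⟩ := lt_sSup_iff.mp h
  exact EReal.coe_le_of_forall_coe_lt fun s hs => le_sSup
    ⟨s, infinite_star_of_infinite p hq hna hC hL hk' ξ hw (EReal.coe_lt_coe_iff.mp hlt) hs hw', rfl⟩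

end Comparison

/-- For `p^k ≤ n < p^{k+1}`:
`w_n(ξ)/p^k − n + 2/p^k − 1 ≤ w_n^*(ξ) ≤ w_n(ξ)` (in the extended reals). -/
theorem wnStar_wn_comparison (p : ℕ) (hp : p.Prime) (q : ℕ) (hq : ∃ e : ℕ, 0 < e ∧ q = p ^ e)
    (Fq : Type) [Field Fq] [Fintype Fq] [CharP Fq p] (hcard : Fintype.card Fq = q)
    (n : ℕ) (hn : 1 ≤ n) (ξ : LaurentSeries Fq)
    (k : ℕ) (hk : p ^ k ≤ n) (hk' : n < p ^ (k + 1)) :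
    wn Fq q n ξ / ((p ^ k : ℝ) : EReal) - (n : EReal) + ((2 / p ^ k : ℝ) : EReal) - 1
        ≤ wnStar Fq q n ξ ∧
      wnStar Fq q n ξ ≤ wn Fq q n ξ := by
  have := Fact.mk hp
  have hq1 : 1 < q := hcard ▸ Fintype.one_lt_card
  have hle := wnStar_le_wn hq1 n ξ
  refine ⟨?_, hle⟩
  have hneg := neg_one_le_wnStar hq1 hn ξ
  have hpk : (1 : ℝ) ≤ (p : ℝ) ^ k := one_le_pow₀ (by exact_mod_cast hp.one_lt.le)
  have hpk0 : (0 : ℝ) < (p : ℝ) ^ k := zero_lt_one.trans_le hpk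
  have hkey := fun w => le_wnStar_of_lt_wn (w := w) p hq1 hk' ξ
  generalize wn Fq q n ξ = W at *
  generalize wnStar Fq q n ξ = V at *
  induction W with
  | bot => exact absurd (hneg.trans hle) (not_le.mpr (EReal.bot_lt_coe _))
  | top =>
    have : V = ⊤ := by
      refine EReal.eq_top_iff_forall_lt V |>.mpr fun s => ?_
      set w := max 0 ((s + 1 + n + 1) * (p : ℝ) ^ k)
      refine lt_of_lt_of_le (EReal.coe_lt_coe_iff.mpr ?_)
        (hkey w (by linarith [le_max_left 0 ((s + 1 + n + 1) * (p : ℝ) ^ k)]) (EReal.coe_lt_top w))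
      have : s + 1 + n + 1 < (w + 2) / p ^ k := by
        rw [lt_div_iff₀ hpk0]
        linarith [le_max_right 0 ((s + 1 + n + 1) * (p : ℝ) ^ k)]
      linarith
    rw [this]
    exact le_top
  | coe r =>
    have hcoe : (r : EReal) / ((p ^ k : ℝ) : EReal) - (n : EReal) + ((2 / p ^ k : ℝ) : EReal) - 1 =
        ((r / p ^ k - n + 2 / p ^ k - 1 : ℝ) : EReal) := by
      rw [← EReal.coe_div]
      push_cast
      rfl
    rw [hcoe]
    refine EReal.coe_le_of_forall_coe_lt fun s hs => ?_
    have hs' : s + n + 1 < (r + 2) / p ^ k := by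
      rw [add_div]
      linarith
    rw [lt_div_iff₀ hpk0] at hs'
    rcases le_or_gt r (-1) with hr | hr
    · refine (EReal.coe_le_coe_iff.mpr ?_).trans hneg
      have hn' : (1 : ℝ) ≤ n := by exact_mod_cast hn
      by_contra! hlt
      have : 1 * (p : ℝ) ^ k ≤ (s + n + 1) * p ^ k :=
        mul_le_mul_of_nonneg_right (by linarith) hpk0.le
      linarith
    · set w := max ((r - 1) / 2) ((s + n + 1) * (p : ℝ) ^ k - 2) with hw
      have h1 := hkey w (lt_max_of_lt_left (by linarith))
        (EReal.coe_lt_coe_iff.mpr (max_lt (by linarith) (by linarith)))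
      refine (EReal.coe_le_coe_iff.mpr ?_).trans h1
      have : s + n + 1 ≤ (w + 2) / p ^ k := by
        rw [le_div_iff₀ hpk0]
        linarith [le_max_right ((r - 1) / 2) ((s + n + 1) * (p : ℝ) ^ k - 2)]
      linarith
end
end

section
/- Let α and β be distinct elements of the algebraic closure of F_q(T), of degrees m and n respectively over F_q(T). Then |α − β| ≥ H(α)^{-n} H(β)^{-m}. -/
open Polynomial Filter Set
open scoped Classical

noncomputable section

open OotoT

namespace OotoT

section GaussNorm

variable {L : Type*} [Field L] {v : AbsoluteValue L ℝ}

lemma apply_eval_le_gaussNorm_mul_pow (hv : IsNonarchimedean v) (F : L[X]) (x : L) {k : ℕ}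
    (hk : F.natDegree ≤ k) : v (F.eval x) ≤ F.gaussNorm v 1 * max 1 (v x) ^ k := by
  rw [eval_eq_sum_range]
  obtain ⟨i, hi, h⟩ := hv.finset_image_add_of_nonempty (fun i => F.coeff i * x ^ i)
    (Finset.nonempty_range_add_one (n := F.natDegree))
  refine h.trans ?_
  rw [map_mul, map_pow]
  have hcoeff : v (F.coeff i) ≤ F.gaussNorm v 1 := by
    simpa using F.le_gaussNorm v zero_le_one i
  have hpow : v x ^ i ≤ max 1 (v x) ^ k :=
    (pow_le_pow_left₀ (v.nonneg x) (le_max_right _ _) i).trans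
      (pow_le_pow_right₀ (le_max_left _ _) (by have := Finset.mem_range.mp hi; omega))
  exact mul_le_mul hcoeff hpow (pow_nonneg (v.nonneg x) i) (F.gaussNorm_nonneg v zero_le_one)

lemma gaussNorm_le_of_forall_coeff_le {F : L[X]} {B : ℝ}
    (h : ∀ i, v (F.coeff i) ≤ B) : F.gaussNorm v 1 ≤ B := by
  obtain ⟨i, hi⟩ := F.exists_eq_gaussNorm v 1
  simpa [hi] using h i

lemma max_one_le_gaussNorm_X_sub_C (a : L) :
    max 1 (v a) ≤ (X - C a : L[X]).gaussNorm v 1 := by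
  refine max_le ?_ ?_
  · have h := (X - C a : L[X]).le_gaussNorm v zero_le_one 1
    rwa [coeff_sub, coeff_X_one, coeff_C_succ, sub_zero, map_one, one_pow, mul_one] at h
  · have h := (X - C a : L[X]).le_gaussNorm v zero_le_one 0
    rwa [coeff_sub, coeff_X_zero, coeff_C_zero, zero_sub, v.map_neg, pow_zero, mul_one] at h

lemma mul_prod_max_one_le_gaussNorm (hv : IsNonarchimedean v) (a : L) (s : Multiset L) :
    v a * (s.map fun x => max 1 (v x)).prod ≤
      (C a * (s.map fun x => X - C x).prod).gaussNorm v 1 := by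
  induction s using Multiset.induction with
  | empty => simp
  | cons x s ih =>
    rw [Multiset.map_cons, Multiset.prod_cons, Multiset.map_cons, Multiset.prod_cons,
      mul_left_comm, mul_left_comm (C a), gaussNorm_mul hv one_pos]
    refine mul_le_mul (max_one_le_gaussNorm_X_sub_C x) ih ?_ (gaussNorm_nonneg _ _ zero_le_one)
    exact mul_nonneg (v.nonneg a) (Multiset.prod_nonneg fun y hy => by
      obtain ⟨z, -, rfl⟩ := Multiset.mem_map.mp hy
      positivity)

lemma gaussNorm_hasseDeriv_le (hv : IsNonarchimedean v) (k : ℕ) (F : L[X]) :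
    (hasseDeriv k F).gaussNorm v 1 ≤ F.gaussNorm v 1 := by
  refine gaussNorm_le_of_forall_coeff_le fun i => ?_
  rw [hasseDeriv_coeff, map_mul]
  have hnat : v (((i + k).choose k : ℕ) : L) ≤ 1 :=
    hv.apply_natCast_le_one
  have hcoeff : v (F.coeff (i + k)) ≤ F.gaussNorm v 1 := by
    simpa using F.le_gaussNorm v zero_le_one (i + k)
  nlinarith [v.nonneg (F.coeff (i + k))]

lemma eval_hasseDeriv_of_eq_X_sub_C_pow_mul {F V : L[X]} {a : L} {k : ℕ}
    (h : F = (X - C a) ^ k * V) : (hasseDeriv k F).eval a = V.eval a := by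
  rw [← taylor_coeff, h, taylor_mul, taylor_pow, map_sub, taylor_X, taylor_C, add_sub_cancel_right,
    coeff_X_pow_mul', if_pos le_rfl, Nat.sub_self, taylor_coeff_zero]

end GaussNorm

section Liouville

variable {A L : Type*} [CommRing A] [Field L]
  {φ : A →+* L} {v : AbsoluteValue L ℝ}

lemma eval₂_ne_zero_of_irreducible [IsDomain A] [Nonempty (NormalizedGCDMonoid A)]
    (hφ : Function.Injective φ) {P R : A[X]}
    (hP : Irreducible P) (hprim : P.IsPrimitive) {α γ : L} (hα : P.eval₂ φ α = 0)
    (hγ : P.eval₂ φ γ = 0) (hR : R.eval₂ φ α ≠ 0) : R.eval₂ φ γ ≠ 0 := by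
  obtain ⟨_⟩ := ‹Nonempty (NormalizedGCDMonoid A)›
  let ψ : FractionRing A →+* L := IsFractionRing.lift hφ
  have hψ : ψ.comp (algebraMap A (FractionRing A)) = φ :=
    RingHom.ext fun a => IsFractionRing.lift_algebraMap hφ a
  have heval (F : A[X]) (x : L) : (F.map (algebraMap A (FractionRing A))).eval₂ ψ x =
      F.eval₂ φ x := by rw [eval₂_map, hψ]
  have hirr := (hprim.irreducible_iff_irreducible_map_fraction_map (K := FractionRing A)).mp hP
  rcases dvd_or_isCoprime _ (R.map (algebraMap A (FractionRing A))) hirr with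
    ⟨U, hU⟩ | ⟨a, b, hab⟩
  · refine absurd ?_ hR
    rw [← heval, hU, eval₂_mul, heval, hα, zero_mul]
  · intro h
    have := congrArg (eval₂ ψ γ) hab
    rw [eval₂_add, eval₂_mul, eval₂_mul, heval, heval, hγ, h] at this
    simp at this

/-- The resultant of `P` and `R` is a nonzero element of `A`; bound its factors `R(γ)` trivially at
all roots `γ` of `P` except `α`. -/
lemma one_le_mul_gaussNorm_pow_of_eval_ne_zero [IsAlgClosed L] (hφ : Function.Injective φ)
    (hv : IsNonarchimedean v) (hint : ∀ a, a ≠ 0 → 1 ≤ v (φ a)) {P R : A[X]} {α : L} {k : ℕ}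
    {δ B : ℝ} (hP0 : P ≠ 0) (hα : P.eval₂ φ α = 0)
    (hR : ∀ γ, P.eval₂ φ γ = 0 → R.eval₂ φ γ ≠ 0) (hk : R.natDegree ≤ k)
    (hB : (R.map φ).gaussNorm v 1 ≤ B) (hδ : v (R.eval₂ φ α) ≤ δ * (B * max 1 (v α) ^ k)) :
    1 ≤ δ * (B ^ P.natDegree * (P.map φ).gaussNorm v 1 ^ k) := by
  set f := P.map φ with hf
  set g := R.map φ with hg
  have hf0 : f ≠ 0 := (Polynomial.map_ne_zero_iff hφ).mpr hP0
  have hroot (γ : L) : γ ∈ f.roots ↔ P.eval₂ φ γ = 0 := by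
    rw [mem_roots hf0, IsRoot.def, hf, eval_map]
  have hsplit : f.Splits := IsAlgClosed.splits f
  have hres := resultant_eq_prod_eval f g k (natDegree_map_le.trans hk) hsplit
  have hfd : f.natDegree = P.natDegree := natDegree_map_eq_of_injective hφ P
  have hres0 : resultant f g f.natDegree k ≠ 0 := by
    rw [hres]
    refine mul_ne_zero (pow_ne_zero _ (leadingCoeff_ne_zero.mpr hf0)) (Multiset.prod_ne_zero ?_)
    intro h
    obtain ⟨γ, hγ, h0⟩ := Multiset.mem_map.mp h
    exact hR γ ((hroot γ).mp hγ) (by rw [← eval_map]; exact h0)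
  have hone : 1 ≤ v (resultant f g f.natDegree k) := by
    rw [hfd, hf, hg, resultant_map_map] at hres0 ⊢
    exact hint _ fun h => hres0 (by rw [h, map_zero])
  have hB0 : 0 ≤ B := (gaussNorm_nonneg _ _ zero_le_one).trans hB
  obtain ⟨s, hs⟩ := Multiset.exists_cons_of_mem ((hroot α).mpr hα)
  have hprod : v (s.map g.eval).prod ≤ B ^ Multiset.card s *
      (s.map fun x => max 1 (v x)).prod ^ k := by
    clear hs
    induction s using Multiset.induction with
    | empty => simp
    | cons x s ih =>
      simp only [Multiset.map_cons, Multiset.prod_cons, map_mul, Multiset.card_cons]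
      have hx : v (g.eval x) ≤ B * max 1 (v x) ^ k :=
        (apply_eval_le_gaussNorm_mul_pow hv g x (natDegree_map_le.trans hk)).trans (by gcongr)
      calc _ ≤ (B * max 1 (v x) ^ k) *
            (B ^ Multiset.card s * (s.map fun x => max 1 (v x)).prod ^ k) :=
            mul_le_mul hx ih (v.nonneg _) (by positivity)
        _ = _ := by ring
  have hgauss : v f.leadingCoeff * (f.roots.map fun x => max 1 (v x)).prod ≤ f.gaussNorm v 1 := by
    have := mul_prod_max_one_le_gaussNorm hv f.leadingCoeff f.roots
    rwa [← hsplit.eq_prod_roots] at this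
  have hcard : P.natDegree = Multiset.card s + 1 := by
    rw [← hfd, hsplit.natDegree_eq_card_roots, hs, Multiset.card_cons]
  have hδ0 : 0 ≤ δ * B := by
    have h := (v.nonneg _).trans hδ
    rw [← mul_assoc] at h
    exact nonneg_of_mul_nonneg_left h (by positivity)
  rw [hres, hs] at hone
  rw [hs] at hgauss
  simp only [Multiset.map_cons, Multiset.prod_cons, map_mul, map_pow] at hone hgauss
  rw [← eval_map] at hδ
  have hS : 0 ≤ (s.map fun x => max 1 (v x)).prod := Multiset.prod_nonneg fun y hy => by
    obtain ⟨z, -, rfl⟩ := Multiset.mem_map.mp hy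
    positivity
  calc (1 : ℝ) ≤ _ := hone
    _ ≤ v f.leadingCoeff ^ k * ((δ * (B * max 1 (v α) ^ k)) * (B ^ Multiset.card s *
      (s.map fun x => max 1 (v x)).prod ^ k)) := by
        have := (v.nonneg _).trans hδ
        gcongr
    _ = δ * B * (B ^ Multiset.card s * (v f.leadingCoeff * (max 1 (v α) *
      (s.map fun x => max 1 (v x)).prod)) ^ k) := by ring
    _ ≤ δ * B * (B ^ Multiset.card s * f.gaussNorm v 1 ^ k) := by gcongr
    _ = _ := by rw [hcard]; ring

/-- Liouville's inequality in Gauss-norm form. If `Q` vanishes at `α` to order `k`, the `k`-th Hasse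
derivative of `Q` does not vanish at `α` and has `α - β` as a factor there, so its resultant with
`P` is a nonzero element of `A`. This covers conjugate and inseparable `α`, `β` uniformly. -/
theorem one_le_abv_sub_mul_gaussNorm_pow [IsDomain A] [Nonempty (NormalizedGCDMonoid A)]
    [IsAlgClosed L] (hφ : Function.Injective φ)
    (hv : IsNonarchimedean v) (hint : ∀ a, a ≠ 0 → 1 ≤ v (φ a)) {P Q : A[X]} {α β : L}
    (hP : Irreducible P) (hprim : P.IsPrimitive) (hα : P.eval₂ φ α = 0) (hQ : Q ≠ 0)
    (hβ : Q.eval₂ φ β = 0) (hne : α ≠ β) :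
    1 ≤ v (α - β) *
      ((Q.map φ).gaussNorm v 1 ^ P.natDegree * (P.map φ).gaussNorm v 1 ^ Q.natDegree) := by
  set f := Q.map φ with hf
  have hf0 : f ≠ 0 := (Polynomial.map_ne_zero_iff hφ).mpr hQ
  obtain ⟨V, hV, hVα⟩ := exists_eq_pow_rootMultiplicity_mul_and_not_dvd f hf0 α
  set k := f.rootMultiplicity α
  have hVα' : V.eval α ≠ 0 := fun h => hVα (dvd_iff_isRoot.mpr h)
  have hVβ : V.IsRoot β := by
    have h : f.eval β = 0 := by rw [hf, eval_map, hβ]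
    rw [hV, eval_mul, eval_pow, eval_sub, eval_X, eval_C] at h
    exact (mul_eq_zero.mp h).resolve_left (pow_ne_zero _ (sub_ne_zero.mpr hne.symm))
  obtain ⟨W, hW⟩ := dvd_iff_isRoot.mpr hVβ
  have hRmap : (hasseDeriv k Q).map φ = hasseDeriv k f := by
    ext i
    simp [hf, hasseDeriv_coeff]
  have hReval : (hasseDeriv k Q).eval₂ φ α = V.eval α := by
    rw [← eval_map, hRmap, eval_hasseDeriv_of_eq_X_sub_C_pow_mul hV]
  have hW0 : W ≠ 0 := by
    rintro rfl
    simp [hW] at hVα'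
  have hfW : f = (X - C α) ^ k * (X - C β) * W := by rw [hV, hW, mul_assoc]
  have hdeg : W.natDegree ≤ Q.natDegree := by
    rw [← natDegree_map_eq_of_injective hφ Q, ← hf]
    exact natDegree_le_of_dvd ⟨_, hfW.trans (mul_comm _ _)⟩ hf0
  have hGX (a : L) : 1 ≤ (X - C a : L[X]).gaussNorm v 1 :=
    (le_max_left _ _).trans (max_one_le_gaussNorm_X_sub_C a)
  have hGpow (j : ℕ) : 1 ≤ ((X - C α : L[X]) ^ j).gaussNorm v 1 := by
    induction j with
    | zero => simpa using (gaussNorm_C v 1 (1 : L)).ge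
    | succ j ih =>
      rw [pow_succ, gaussNorm_mul hv one_pos]
      exact one_le_mul_of_one_le_of_one_le ih (hGX α)
  have hGW : W.gaussNorm v 1 ≤ f.gaussNorm v 1 := by
    rw [hfW, gaussNorm_mul hv one_pos, gaussNorm_mul hv one_pos]
    exact le_mul_of_one_le_left (gaussNorm_nonneg _ _ zero_le_one)
      (one_le_mul_of_one_le_of_one_le (hGpow k) (hGX β))
  refine one_le_mul_gaussNorm_pow_of_eval_ne_zero hφ hv hint hP.ne_zero hα
    (R := hasseDeriv k Q) (fun γ hγ => ?_) ((natDegree_hasseDeriv_le Q k).trans (Nat.sub_le _ _))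
    ?_ ?_
  · exact eval₂_ne_zero_of_irreducible hφ hP hprim hα hγ (hReval ▸ hVα')
  · rw [hRmap]
    exact gaussNorm_hasseDeriv_le hv k f
  · rw [hReval, hW, eval_mul, map_mul, eval_sub, eval_X, eval_C]
    gcongr
    refine (apply_eval_le_gaussNorm_mul_pow hv W α hdeg).trans ?_
    gcongr

end Liouville

section Norm

variable {Fq : Type} [Field Fq]
open WithZero Valuation.IsRankOneDiscrete

lemma valuation_eq_exp_neg_order {f : LaurentSeries Fq} (hf : f ≠ 0) :
    Valued.v f = exp (-f.order) := by
  apply le_antisymm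
  · rw [LaurentSeries.valuation_le_iff_coeff_lt_eq_zero]
    exact fun n hn => HahnSeries.coeff_eq_zero_of_lt_order hn
  · by_contra! h
    refine HahnSeries.coeff_order_eq_zero.not.mpr hf ?_
    have h' : Valued.v f ≤ exp (-(f.order + 1)) := by
      have h0 : Valued.v f ≠ 0 := (Valuation.ne_zero_iff _).mpr hf
      rw [← exp_log h0, exp_lt_exp] at h
      rw [← exp_log h0, exp_le_exp]
      omega
    exact (LaurentSeries.valuation_le_iff_coeff_lt_eq_zero Fq).mp h' _ (lt_add_one _)

/-- `absC` is a nonarchimedean absolute value extending `absL`: it is the spectral norm. -/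
lemma exists_abv_eq_absC {q : ℕ} (hq : 1 < q) :
    ∃ v : AbsoluteValue (AC Fq) ℝ, IsNonarchimedean v ∧ (∀ x, v x = absC Fq q x) ∧
      ∀ ξ, v (iota Fq ξ) = absL Fq q ξ := by
  have hsurj := LaurentSeries.valuation_surjective Fq
  have hq' : (1 : NNReal) < q := by exact_mod_cast hq
  have : (Valued.v : Valuation (LaurentSeries Fq)
    (WithZero (Multiplicative ℤ))).IsRankOneDiscrete :=
    Valuation.IsRankOneDiscrete.mk' ((PowerSeries.idealX Fq).valuation (LaurentSeries Fq))
  let : (Valued.v : Valuation (LaurentSeries Fq) (WithZero (Multiplicative ℤ))).RankOne :=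
    rankOne _ hq'
  let : NontriviallyNormedField (LaurentSeries Fq) :=
    Valued.toNontriviallyNormedField _ (WithZero (Multiplicative ℤ))
  have : IsUltrametricDist (LaurentSeries Fq) :=
    Valued.instIsUltrametricDist _ (WithZero (Multiplicative ℤ))
  have hnorm (ξ : LaurentSeries Fq) : ‖ξ‖ = absL Fq q ξ := by
    have h : ‖ξ‖ = (WithZeroMulInt.toNNReal (ne_of_gt (zero_lt_one.trans hq'))
        (Valued.v ξ) : NNReal) := by
      rw [← valueGroup₀_equiv_withZeroMulInt_restrict_apply_of_surjective hsurj]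
      rfl
    rw [h, absL]
    split_ifs with hξ
    · simp [hξ]
    · rw [valuation_eq_exp_neg_order hξ]
      rw [WithZeroMulInt.toNNReal_neg_apply _ exp_ne_zero]
      rw [toAdd_unzero_eq_log, log_exp]
      simp
  refine ⟨{ toFun := spectralNorm (LaurentSeries Fq) (AC Fq)
            map_mul' := map_mul (spectralMulAlgNorm (LaurentSeries Fq) (AC Fq))
            nonneg' := spectralNorm_nonneg
            eq_zero' := fun _ =>
              map_eq_zero_iff_eq_zero (spectralMulAlgNorm (LaurentSeries Fq) (AC Fq))
            add_le' := map_add_le_add (spectralMulAlgNorm (LaurentSeries Fq) (AC Fq)) },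
    isNonarchimedean_spectralNorm, fun x => ?_, fun ξ => ?_⟩
  · change spectralNorm _ _ x = _
    rw [spectralNorm.spectralNorm_eq_norm_coeff_zero_rpow, hnorm, absC, one_div]
  · change spectralNorm _ _ (algebraMap _ _ ξ) = _
    rw [spectralNorm_extends, hnorm]

lemma absL_zero (q : ℕ) : absL Fq q 0 = 0 := if_pos rfl

lemma coeff_ringHomT (c : Fq[X]) (n : ℕ) : (ringHomT Fq c).coeff (-n : ℤ) = c.coeff n := by
  induction c using Polynomial.induction_on' with
  | add f g hf hg => simp [hf, hg]
  | monomial k a =>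
    have hT : Tel Fq ^ k = HahnSeries.single (-k : ℤ) (1 : Fq) := by
      rw [Tel, inv_pow, HahnSeries.single_pow, HahnSeries.inv_single]
      simp
    rw [ringHomT, coe_eval₂RingHom, eval₂_monomial, hT, HahnSeries.C_mul_eq_smul]
    rw [HahnSeries.coeff_smul, HahnSeries.coeff_single, coeff_monomial]
    simp [eq_comm]

lemma one_le_absL_ringHomT {q : ℕ} (hq : 1 < q) {c : Fq[X]} (hc : c ≠ 0) :
    1 ≤ absL Fq q (ringHomT Fq c) := by
  have hcoeff : (ringHomT Fq c).coeff (-c.natDegree : ℤ) ≠ 0 := by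
    rw [coeff_ringHomT]
    exact leadingCoeff_ne_zero.mpr hc
  rw [absL, if_neg (HahnSeries.ne_zero_of_coeff_ne_zero hcoeff)]
  have hord := HahnSeries.order_le_of_coeff_ne_zero hcoeff
  exact one_le_zpow₀ (by exact_mod_cast hq.le) (by omega)

lemma absL_ringHomT_le {q : ℕ} (hq : 1 < q) (c : Fq[X]) :
    absL Fq q (ringHomT Fq c) ≤ (q : ℝ) ^ c.natDegree := by
  rw [absL]
  split_ifs with h
  · positivity
  · rw [← zpow_natCast]
    refine zpow_le_zpow_right₀ (by exact_mod_cast hq.le) ?_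
    by_contra! hlt
    obtain ⟨n, hn⟩ := Int.eq_ofNat_of_zero_le (a := -(ringHomT Fq c).order) (by omega)
    refine HahnSeries.coeff_order_eq_zero.not.mpr h ?_
    rw [show (ringHomT Fq c).order = -n by omega, coeff_ringHomT]
    exact coeff_eq_zero_of_natDegree_lt (by omega)

lemma heightP_pos {q : ℕ} (hq : 1 < q) {P : Fq[X][X]} (hP : P ≠ 0) : 0 < heightP Fq q P := by
  rw [heightP, if_neg hP]
  positivity

lemma absL_ringHomT_coeff_le_heightP {q : ℕ} (hq : 1 < q) (P : Fq[X][X]) (i : ℕ) :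
    absL Fq q (ringHomT Fq (P.coeff i)) ≤ heightP Fq q P := by
  by_cases hi : P.coeff i = 0
  · rw [hi, map_zero, absL_zero, heightP]
    split_ifs <;> positivity
  · rw [heightP, if_neg (by rintro rfl; simp at hi)]
    exact (absL_ringHomT_le hq _).trans (pow_le_pow_right₀ (by exact_mod_cast hq.le)
      (Finset.le_sup (f := fun i => (P.coeff i).natDegree) (mem_support_iff.mpr hi)))

end Norm

end OotoT

/-- Liouville inequality. For distinct `α, β` algebraic over `F_q(T)`,
of degrees `M` and `N` respectively, `|α − β| ≥ H(α)^{-N} H(β)^{-M}`. -/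
theorem liouville_inequality (p : ℕ) (hp : p.Prime) (q : ℕ) (hq : ∃ e : ℕ, 0 < e ∧ q = p ^ e)
    (Fq : Type) [Field Fq] [Fintype Fq] [CharP Fq p] (hcard : Fintype.card Fq = q)
    (α β : AC Fq) (hα : IsAlgT Fq α) (hβ : IsAlgT Fq β) (hne : α ≠ β)
    (M N : ℕ) (hM : degT Fq α = M) (hN : degT Fq β = N) :
    heightT Fq q α ^ (-(N : ℝ)) * heightT Fq q β ^ (-(M : ℝ)) ≤ absC Fq q (α - β) := by
  have hq1 : 1 < q := hcard ▸ Fintype.one_lt_card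
  obtain ⟨v, hv, hvC, hvL⟩ := exists_abv_eq_absC (Fq := Fq) hq1
  obtain ⟨-, hPirr, hPprim, -, hPα⟩ := hα.choose_spec
  obtain ⟨-, hQirr, -, -, hQβ⟩ := hβ.choose_spec
  rw [degT, dif_pos hα] at hM
  rw [degT, dif_pos hβ] at hN
  rw [heightT, dif_pos hα, heightT, dif_pos hβ, ← hvC]
  set P := hα.choose
  set Q := hβ.choose
  have hint (c : Fq[X]) (hc : c ≠ 0) : 1 ≤ v (ringHomTC Fq c) := by
    rw [ringHomTC, RingHom.comp_apply, hvL]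
    exact one_le_absL_ringHomT hq1 hc
  have hinj : Function.Injective (ringHomTC Fq) := by
    rw [injective_iff_map_eq_zero]
    intro c hc
    by_contra hc0
    simpa [hc] using (hint c hc0).trans_lt' zero_lt_one
  have hgauss (F : Fq[X][X]) : (F.map (ringHomTC Fq)).gaussNorm v 1 ≤ heightP Fq q F := by
    refine gaussNorm_le_of_forall_coeff_le fun i => ?_
    rw [coeff_map, ringHomTC, RingHom.comp_apply, hvL]
    exact absL_ringHomT_coeff_le_heightP hq1 F i
  have hmain := one_le_abv_sub_mul_gaussNorm_pow hinj hv hint hPirr hPprim hPα hQirr.ne_zero hQβ hne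
  rw [hM, hN] at hmain
  have hHP := heightP_pos hq1 hPirr.ne_zero
  have hHQ := heightP_pos hq1 hQirr.ne_zero
  have hmain' : 1 ≤ v (α - β) * (heightP Fq q Q ^ M * heightP Fq q P ^ N) := by
    refine hmain.trans (mul_le_mul_of_nonneg_left ?_ (v.nonneg _))
    exact mul_le_mul (pow_le_pow_left₀ (gaussNorm_nonneg _ _ zero_le_one) (hgauss Q) M)
      (pow_le_pow_left₀ (gaussNorm_nonneg _ _ zero_le_one) (hgauss P) N)
      (pow_nonneg (gaussNorm_nonneg _ _ zero_le_one) N) (by positivity)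
  rw [Real.rpow_neg hHP.le, Real.rpow_neg hHQ.le, Real.rpow_natCast, Real.rpow_natCast,
    ← mul_inv, inv_le_iff_one_le_mul₀ (by positivity), mul_comm (_ ^ N)]
  exact hmain'
end
end

section
/- Let ξ ∈ F_q((T^{-1})), let d ≥ 1 be an integer, and let θ, ρ, δ be positive real numbers. Suppose there exist a sequence (α_j)_{j≥1} of pairwise distinct elements of the algebraic closure of F_q(T), each of degree at most d over F_q(T) and each different from ξ, and an increasing, divergent sequence (β_j)_{j≥1} of real numbers with β_j ≥ 1 for all j, such that: d + δ ≤ liminf_{j→∞} (−log|ξ − α_j|)/(log β_j); limsup_{j→∞} (−log|ξ − α_j|)/(log β_j) ≤ d + ρ; limsup_{j→∞} (log β_{j+1})/(log β_j) ≤ θ; and limsup_{j→∞} (log H(α_j))/(log β_j) ≤ 1. Then d + δ − 1 ≤ w_d*(ξ) ≤ (d + ρ)·dθ/δ − 1. -/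
open Polynomial Filter Set
open scoped Classical

noncomputable section

open OotoT

namespace OotoT

/-! ### The absolute value on the algebraic closure -/

section AbsoluteValue

variable (Fq : Type) [Field Fq]

theorem valuation_eq_exp_neg_order_s11 {x : LaurentSeries Fq} (hx : x ≠ 0) :
    (Valued.v x : WithZero (Multiplicative ℤ)) = WithZero.exp (-x.order) := by
  have h0 : (Valued.v x : WithZero (Multiplicative ℤ)) ≠ 0 := by simpa using hx
  apply le_antisymm
  · rw [LaurentSeries.valuation_le_iff_coeff_lt_eq_zero]
    exact fun n hn => HahnSeries.coeff_eq_zero_of_lt_order hn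
  · by_contra! h
    have h2 : (Valued.v x : WithZero (Multiplicative ℤ)) ≤ WithZero.exp (-(x.order + 1)) := by
      rw [← WithZero.log_le_iff_le_exp h0]
      rw [← WithZero.log_lt_iff_lt_exp h0] at h
      omega
    rw [LaurentSeries.valuation_le_iff_coeff_lt_eq_zero] at h2
    exact HahnSeries.coeff_order_eq_zero.not.mpr hx (h2 _ (by omega))

open Valuation.IsRankOneDiscrete in
/-- `absC` is the spectral norm of the algebraic closure, hence a multiplicative
nonarchimedean norm extending `absL`. -/
theorem exists_mulRingNorm_eq_absC {q : ℕ} (hq : 1 < q) :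
    ∃ f : MulRingNorm (AC Fq), IsNonarchimedean f ∧ (∀ x, f x = absC Fq q x) ∧
      ∀ x, f (iota Fq x) = absL Fq q x := by
  have hq' : (1 : NNReal) < q := by exact_mod_cast hq
  have : (Valued.v :
      Valuation (LaurentSeries Fq) (WithZero (Multiplicative ℤ))).IsRankOneDiscrete := by
    rw [LaurentSeries.valuation_def]
    infer_instance
  let : Valuation.RankOne
    (Valued.v : Valuation (LaurentSeries Fq) (WithZero (Multiplicative ℤ))) := rankOne _ hq'
  let := Valued.toNontriviallyNormedField (LaurentSeries Fq) (WithZero (Multiplicative ℤ))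
  have hn : ∀ x : LaurentSeries Fq, ‖x‖ = absL Fq q x := by
    intro x
    have hx' : ‖x‖ = WithZeroMulInt.toNNReal (zero_lt_one.trans hq').ne' (Valued.v x) := by
      rw [← valueGroup₀_equiv_withZeroMulInt_restrict_apply_of_surjective
        (LaurentSeries.valuation_surjective Fq) x]
      rfl
    rw [hx']
    by_cases hx : x = 0
    · simp [hx, absL]
    · rw [valuation_eq_exp_neg_order_s11 _ hx,
        WithZeroMulInt.toNNReal_neg_apply _ WithZero.exp_ne_zero]
      change (((q : NNReal) ^ (-x.order) : NNReal) : ℝ) = _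
      simp [absL, hx]
  refine ⟨(spectralMulAlgNorm (LaurentSeries Fq) (AC Fq)).toMulRingNorm,
    isNonarchimedean_spectralNorm, fun x => ?_, fun x => ?_⟩
  · change spectralNorm (LaurentSeries Fq) (AC Fq) x = _
    rw [spectralNorm.spectralNorm_eq_norm_coeff_zero_rpow, hn]
    simp [absC]
  · change spectralNorm (LaurentSeries Fq) (AC Fq) (algebraMap _ _ x) = _
    rw [spectralNorm_extends, hn]

theorem Tel_pow (n : ℕ) : Tel Fq ^ n = HahnSeries.single (-(n : ℤ)) (1 : Fq) := by
  rw [Tel, inv_pow, HahnSeries.single_pow, inv_eq_iff_eq_inv, HahnSeries.inv_single]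
  simp

theorem ringHomT_monomial (n : ℕ) (a : Fq) :
    ringHomT Fq (monomial n a) = HahnSeries.single (-(n : ℤ)) a := by
  simp [ringHomT, Tel_pow, HahnSeries.C_apply]

theorem coeff_ringHomT_neg (c : Fq[X]) (k : ℕ) :
    (ringHomT Fq c).coeff (-(k : ℤ)) = c.coeff k := by
  induction c using Polynomial.induction_on' with
  | add a b ha hb => simp [ha, hb]
  | monomial n a =>
    rw [ringHomT_monomial, HahnSeries.coeff_single, coeff_monomial]
    simp [eq_comm]

theorem absL_ringHomT (q : ℕ) {c : Fq[X]} (hc : c ≠ 0) :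
    absL Fq q (ringHomT Fq c) = (q : ℝ) ^ c.natDegree := by
  have hlead : (ringHomT Fq c).coeff (-(c.natDegree : ℤ)) ≠ 0 := by
    rw [coeff_ringHomT_neg]
    simpa using hc
  have hne : ringHomT Fq c ≠ 0 := fun h => hlead (by simp [h])
  have horder : (ringHomT Fq c).order = -(c.natDegree : ℤ) := by
    refine le_antisymm (HahnSeries.order_le_of_coeff_ne_zero hlead) ?_
    by_contra! h
    obtain ⟨k, hk⟩ := Int.eq_ofNat_of_zero_le (a := -(ringHomT Fq c).order) (by omega)
    have h1 := HahnSeries.coeff_order_eq_zero.not.mpr hne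
    rw [show (ringHomT Fq c).order = -(k : ℤ) by omega, coeff_ringHomT_neg] at h1
    exact h1 (coeff_eq_zero_of_natDegree_lt (by omega))
  rw [absL, if_neg hne, horder]
  simp

end AbsoluteValue

/-! ### Resultants and coefficient degrees -/

section CoeffDegree

variable {F : Type} [Field F]

/-- All coefficients of a bivariate polynomial have degree at most `h`. -/
def CoeffDegreeLE (h : ℕ) (R : F[X][X]) : Prop := ∀ i, (R.coeff i).natDegree ≤ h

theorem CoeffDegreeLE.zero (h : ℕ) : CoeffDegreeLE h (0 : F[X][X]) := fun i => by simp

theorem CoeffDegreeLE.add {h : ℕ} {R S : F[X][X]} (hR : CoeffDegreeLE h R)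
    (hS : CoeffDegreeLE h S) : CoeffDegreeLE h (R + S) := fun i => by
  rw [coeff_add]
  exact natDegree_add_le_of_degree_le (hR i) (hS i)

theorem CoeffDegreeLE.sum {ι : Type*} {h : ℕ} {s : Finset ι} {R : ι → F[X][X]}
    (hR : ∀ i ∈ s, CoeffDegreeLE h (R i)) : CoeffDegreeLE h (∑ i ∈ s, R i) :=
  Finset.sum_induction _ _ (fun _ _ => CoeffDegreeLE.add) (CoeffDegreeLE.zero h) hR

theorem CoeffDegreeLE.mul {h k : ℕ} {R S : F[X][X]} (hR : CoeffDegreeLE h R)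
    (hS : CoeffDegreeLE k S) : CoeffDegreeLE (h + k) (R * S) := fun i => by
  rw [coeff_mul]
  exact natDegree_sum_le_of_forall_le _ _ fun x _ => natDegree_mul_le_of_le (hR _) (hS _)

theorem CoeffDegreeLE.C {h : ℕ} {c : F[X]} (hc : c.natDegree ≤ h) :
    CoeffDegreeLE h (Polynomial.C c) := fun i => by
  rw [coeff_C]
  split_ifs <;> simp [hc]

theorem CoeffDegreeLE.X_pow (n : ℕ) : CoeffDegreeLE 0 (X ^ n : F[X][X]) := fun i => by
  rw [coeff_X_pow]
  split_ifs <;> simp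

theorem CoeffDegreeLE.natCast (n : ℕ) : CoeffDegreeLE 0 (n : F[X][X]) := by
  rw [← C_eq_natCast]
  exact CoeffDegreeLE.C (by simp)

theorem CoeffDegreeLE.units_smul {h : ℕ} {R : F[X][X]} (u : ℤˣ) (hR : CoeffDegreeLE h R) :
    CoeffDegreeLE h (u • R) := fun i => by
  rcases Int.units_eq_one_or u with rfl | rfl <;> simpa using hR i

theorem CoeffDegreeLE.prod {ι : Type*} {h : ℕ} (s : Finset ι) {R : ι → F[X][X]}
    (hR : ∀ i, CoeffDegreeLE h (R i)) : CoeffDegreeLE (s.card * h) (∏ i ∈ s, R i) := by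
  induction s using Finset.induction_on with
  | empty => simpa using CoeffDegreeLE.natCast (F := F) 1
  | insert a s ha ih =>
    rw [Finset.prod_insert ha, Finset.card_insert_of_notMem ha, add_mul, one_mul, add_comm]
    exact (hR a).mul ih

theorem CoeffDegreeLE.resultant {h k : ℕ} {f g : F[X][X][X]} (m n : ℕ)
    (hf : ∀ i, CoeffDegreeLE h (f.coeff i)) (hg : ∀ i, CoeffDegreeLE k (g.coeff i)) :
    CoeffDegreeLE (m * k + n * h) (f.resultant g m n) := by
  rw [Polynomial.resultant, Matrix.det_apply]
  refine CoeffDegreeLE.sum fun σ _ => CoeffDegreeLE.units_smul _ ?_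
  rw [Fin.prod_univ_add]
  refine CoeffDegreeLE.mul ?_ ?_
  · have := CoeffDegreeLE.prod (h := k) (Finset.univ : Finset (Fin m))
      (R := fun i => f.sylvester g m n (σ (Fin.castAdd n i)) (Fin.castAdd n i)) fun i => by
        simp only [sylvester, Matrix.of_apply, Fin.addCases_left]
        split_ifs
        exacts [hg _, CoeffDegreeLE.zero _]
    simpa using this
  · have := CoeffDegreeLE.prod (h := h) (Finset.univ : Finset (Fin n))
      (R := fun i => f.sylvester g m n (σ (Fin.natAdd m i)) (Fin.natAdd m i)) fun i => by
        simp only [sylvester, Matrix.of_apply, Fin.addCases_right]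
        split_ifs
        exacts [hf _, CoeffDegreeLE.zero _]
    simpa using this

theorem CoeffDegreeLE.taylor {h : ℕ} {Q : F[X][X]} (hQ : CoeffDegreeLE h Q) (i : ℕ) :
    CoeffDegreeLE h ((Polynomial.taylor X (Q.map Polynomial.C)).coeff i) := by
  rw [Q.as_sum_range, Polynomial.map_sum, map_sum, finsetSum_coeff]
  refine CoeffDegreeLE.sum fun k _ => ?_
  rw [map_monomial, taylor_monomial, coeff_C_mul, coeff_X_add_C_pow]
  exact (CoeffDegreeLE.C (hQ k)).mul ((CoeffDegreeLE.X_pow _).mul (CoeffDegreeLE.natCast _))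

/-- The polynomial `Res_X(P(X), Q(X + Y))` in `Y`, which vanishes at the differences of roots
of `Q` and `P`. -/
def diffResultant (P Q : F[X][X]) : F[X][X] :=
  (P.map Polynomial.C).resultant (taylor X (Q.map Polynomial.C)) P.natDegree Q.natDegree

theorem CoeffDegreeLE.diffResultant {h k : ℕ} {P Q : F[X][X]} (hP : CoeffDegreeLE h P)
    (hQ : CoeffDegreeLE k Q) :
    CoeffDegreeLE (P.natDegree * k + Q.natDegree * h) (diffResultant P Q) :=
  CoeffDegreeLE.resultant _ _ (fun i => by rw [coeff_map]; exact CoeffDegreeLE.C (hP i)) hQ.taylor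

variable {L : Type} [Field L] {φ : F[X] →+* L}

theorem eval₂_diffResultant (hφ : Function.Injective φ) (P Q : F[X][X]) (y : L) :
    (diffResultant P Q).eval₂ φ y = (P.map φ).resultant (taylor y (Q.map φ)) := by
  have h1 : (eval₂RingHom φ y).comp Polynomial.C = φ := by ext <;> simp
  have h2 : eval₂RingHom φ y X = y := eval₂_X _ _
  rw [← coe_eval₂RingHom, diffResultant, ← resultant_map_map, map_taylor, Polynomial.map_map,
    Polynomial.map_map, h1, h2, natDegree_taylor, natDegree_map_eq_of_injective hφ,
    natDegree_map_eq_of_injective hφ]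

theorem eval₂_diffResultant_eq_zero (hφ : Function.Injective φ) {P Q : F[X][X]} (hP : P ≠ 0)
    {a b : L} (ha : P.eval₂ φ a = 0) (hb : Q.eval₂ φ b = 0) :
    (diffResultant P Q).eval₂ φ (b - a) = 0 := by
  rw [eval₂_diffResultant hφ, resultant_eq_zero_iff]
  refine ⟨Or.inl ((Polynomial.map_ne_zero_iff hφ).mpr hP), fun hco => ?_⟩
  obtain ⟨u, v, huv⟩ := hco
  have := congrArg (eval a) huv
  simp [taylor_eval, eval_map, ha, hb] at this

theorem diffResultant_ne_zero [IsAlgClosed L] (hφ : Function.Injective φ) {P Q : F[X][X]}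
    (hP : P ≠ 0) (hQ : Q ≠ 0) : diffResultant P Q ≠ 0 := by
  have hP' := (Polynomial.map_ne_zero_iff hφ).mpr hP
  have hQ' := (Polynomial.map_ne_zero_iff hφ).mpr hQ
  have : Infinite L := IsAlgClosed.instInfinite
  obtain ⟨y, hy⟩ := Infinite.exists_notMem_finset
    (Finset.image₂ (fun b a => b - a) (Q.map φ).roots.toFinset (P.map φ).roots.toFinset)
  intro h
  have h1 := eval₂_diffResultant hφ P Q y
  rw [h, eval₂_zero, eq_comm, resultant_eq_zero_iff] at h1
  refine h1.2 ((isCoprime_iff_aeval_ne_zero_of_isAlgClosed L L _ _).mpr fun a => ?_)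
  by_contra! hcon
  simp only [coe_aeval_eq_eval, taylor_eval] at hcon
  refine hy (Finset.mem_image₂.mpr ⟨a + y, ?_, a, ?_, by ring⟩)
  · simpa [hQ'] using hcon.2
  · simpa [hP'] using hcon.1

end CoeffDegree

/-! ### Liouville's inequality -/

section Liouville

variable {F L : Type} [Field F] [Field L] {φ : F[X] →+* L} {f : MulRingNorm L} {q : ℕ}

theorem apply_eval₂_le_pow (hq : 1 < q) (hf : IsNonarchimedean f)
    (hφ : ∀ c : F[X], c ≠ 0 → f (φ c) = (q : ℝ) ^ c.natDegree) {N : ℕ} {R : F[X][X]}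
    (hR : CoeffDegreeLE N R) {y : L} (hy : f y ≤ 1) : f (R.eval₂ φ y) ≤ (q : ℝ) ^ N := by
  have hq1 : (1 : ℝ) ≤ q := by exact_mod_cast hq.le
  rw [eval₂_eq_sum_range]
  refine Finset.sum_induction _ (fun x => f x ≤ (q : ℝ) ^ N)
    (fun a b ha hb => (hf a b).trans (max_le ha hb)) (by simp) fun i _ => ?_
  rw [map_mul, map_pow]
  refine (mul_le_of_le_one_right (apply_nonneg f _) (pow_le_one₀ (apply_nonneg f _) hy)).trans ?_
  by_cases hc : R.coeff i = 0
  · simp [hc]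
  · rw [hφ _ hc]
    exact pow_le_pow_right₀ hq1 (hR i)

theorem one_le_pow_mul_of_eval₂_eq_zero (hq : 1 < q) (hf : IsNonarchimedean f)
    (hφ : ∀ c : F[X], c ≠ 0 → f (φ c) = (q : ℝ) ^ c.natDegree) {N : ℕ} {R : F[X][X]}
    (hR : CoeffDegreeLE N R) (hR0 : R ≠ 0) {y : L} (hy0 : y ≠ 0) (hy : R.eval₂ φ y = 0) :
    1 ≤ (q : ℝ) ^ N * f y := by
  have hq1 : (1 : ℝ) ≤ q := by exact_mod_cast hq.le
  rcases le_total 1 (f y) with hy1 | hy1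
  · exact one_le_mul_of_one_le_of_one_le (one_le_pow₀ hq1) hy1
  induction hn : R.natDegree using Nat.strong_induction_on generalizing R with
  | _ n ih =>
    have hdiv : CoeffDegreeLE N R.divX := fun i => by rw [coeff_divX]; exact hR _
    have heval : R.divX.eval₂ φ y * y + φ (R.coeff 0) = 0 := by
      conv_rhs => rw [← hy, ← divX_mul_X_add R]
      simp
    by_cases hc : R.coeff 0 = 0
    · rw [hc, map_zero, add_zero, mul_eq_zero, or_iff_left hy0] at heval
      have hdiv0 : R.divX ≠ 0 := fun h => hR0 (by rw [← divX_mul_X_add R, h, hc]; simp)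
      have hdeg : R.natDegree ≠ 0 := fun h =>
        hR0 (by rw [eq_C_of_natDegree_eq_zero h, hc, map_zero])
      exact ih _ (by rw [natDegree_divX_eq_natDegree_tsub_one]; omega) hdiv hdiv0 heval rfl
    · have h1 : f (φ (R.coeff 0)) = f (R.divX.eval₂ φ y) * f y := by
        rw [← map_mul, eq_neg_of_add_eq_zero_left heval, map_neg_eq_map]
      have h2 : 1 ≤ f (φ (R.coeff 0)) := by
        rw [hφ _ hc]
        exact one_le_pow₀ hq1
      rw [h1] at h2
      exact h2.trans (mul_le_mul_of_nonneg_right (apply_eval₂_le_pow hq hf hφ hdiv hy1)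
        (apply_nonneg f _))

/-- Liouville's inequality for two distinct algebraic elements, possibly conjugate. -/
theorem one_le_pow_mul_apply_sub [IsAlgClosed L] (hq : 1 < q) (hf : IsNonarchimedean f)
    (hφ : ∀ c : F[X], c ≠ 0 → f (φ c) = (q : ℝ) ^ c.natDegree) {h k : ℕ} {P Q : F[X][X]}
    (hP : CoeffDegreeLE h P) (hQ : CoeffDegreeLE k Q) (hP0 : P ≠ 0) (hQ0 : Q ≠ 0) {a b : L}
    (ha : P.eval₂ φ a = 0) (hb : Q.eval₂ φ b = 0) (hab : a ≠ b) :
    1 ≤ (q : ℝ) ^ (P.natDegree * k + Q.natDegree * h) * f (b - a) := by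
  have hinj : Function.Injective φ := by
    rw [injective_iff_map_eq_zero]
    intro c hc
    by_contra hc0
    have := hφ c hc0
    rw [hc, map_zero] at this
    have hq0 : (0 : ℝ) < q := by exact_mod_cast zero_lt_one.trans hq
    exact (pow_pos hq0 _).ne this
  exact one_le_pow_mul_of_eval₂_eq_zero hq hf hφ (hP.diffResultant hQ)
    (diffResultant_ne_zero hinj hP0 hQ0) (sub_ne_zero.mpr hab.symm)
    (eval₂_diffResultant_eq_zero hinj hP0 ha hb)

end Liouville

section Height

variable {Fq : Type} [Field Fq] {q d : ℕ}

theorem coeffDegreeLE_sup (P : Fq[X][X]) :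
    CoeffDegreeLE (P.support.sup fun i => (P.coeff i).natDegree) P := fun i => by
  by_cases hi : i ∈ P.support
  · exact Finset.le_sup (f := fun i => (P.coeff i).natDegree) hi
  · simp [notMem_support_iff.mp hi]

/-- The data of a minimal polynomial of bounded degree that enters into the estimates. -/
theorem exists_annihilator_heightT (q : ℕ) {a : AC Fq} (ha : IsAlgT Fq a) (had : degT Fq a ≤ d) :
    ∃ (P : Fq[X][X]) (h : ℕ), P ≠ 0 ∧ P.natDegree ≤ d ∧ CoeffDegreeLE h P ∧
      P.eval₂ (ringHomTC Fq) a = 0 ∧ heightT Fq q a = (q : ℝ) ^ h := by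
  obtain ⟨-, hirr, -, -, hroot⟩ := ha.choose_spec
  rw [degT, dif_pos ha] at had
  refine ⟨ha.choose, _, hirr.ne_zero, had, coeffDegreeLE_sup _, hroot, ?_⟩
  rw [heightT, dif_pos ha, heightP, if_neg hirr.ne_zero]

theorem one_le_heightT (hq : 1 < q) {a : AC Fq} (ha : IsAlgT Fq a) : 1 ≤ heightT Fq q a := by
  obtain ⟨P, h, -, -, -, -, hh⟩ := exists_annihilator_heightT q ha le_rfl
  rw [hh]
  exact one_le_pow₀ (by exact_mod_cast hq.le)

theorem absC_pos (hq : 1 < q) {x : AC Fq} (hx : x ≠ 0) : 0 < absC Fq q x := by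
  obtain ⟨f, -, hfC, -⟩ := exists_mulRingNorm_eq_absC Fq hq
  rw [← hfC]
  exact map_pos_of_ne_zero f hx

theorem absC_sub_le_max (hq : 1 < q) (x a b : AC Fq) :
    absC Fq q (b - a) ≤ max (absC Fq q (x - a)) (absC Fq q (x - b)) := by
  obtain ⟨f, hf, hfC, -⟩ := exists_mulRingNorm_eq_absC Fq hq
  simp only [← hfC]
  rw [map_sub_rev f x b, show b - a = (x - a) + (b - x) by ring]
  exact hf _ _

theorem neg_log_absC_sub_le (hq : 1 < q) {a b : AC Fq} (ha : IsAlgT Fq a) (hb : IsAlgT Fq b)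
    (had : degT Fq a ≤ d) (hbd : degT Fq b ≤ d) (hab : a ≠ b) :
    -Real.log (absC Fq q (b - a)) ≤
      d * Real.log (heightT Fq q a) + d * Real.log (heightT Fq q b) := by
  have hpos := absC_pos hq (sub_ne_zero.mpr hab.symm)
  obtain ⟨f, hf, hfC, hfL⟩ := exists_mulRingNorm_eq_absC Fq hq
  obtain ⟨P, h, hP0, hPd, hP, hPa, hh⟩ := exists_annihilator_heightT q ha had
  obtain ⟨Q, k, hQ0, hQd, hQ, hQb, hk⟩ := exists_annihilator_heightT q hb hbd
  have hq1 : (1 : ℝ) < q := by exact_mod_cast hq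
  have hφ : ∀ c : Fq[X], c ≠ 0 → f (ringHomTC Fq c) = (q : ℝ) ^ c.natDegree := fun c hc => by
    rw [ringHomTC, RingHom.comp_apply, hfL, absL_ringHomT Fq q hc]
  have key := one_le_pow_mul_apply_sub hq hf hφ hP hQ hP0 hQ0 hPa hQb hab
  rw [hfC] at key
  have hlog := Real.log_nonneg key
  rw [Real.log_mul (by positivity) hpos.ne', Real.log_pow] at hlog
  rw [hh, hk, Real.log_pow, Real.log_pow]
  have hexp : P.natDegree * k + Q.natDegree * h ≤ d * h + d * k := by
    rw [add_comm]
    gcongr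
  have hexp' : ((P.natDegree * k + Q.natDegree * h : ℕ) : ℝ) ≤ d * h + d * k := by
    exact_mod_cast hexp
  nlinarith [mul_le_mul_of_nonneg_right hexp' (Real.log_pos hq1).le]

theorem finite_setOf_coeffDegreeLE [Finite Fq] (d h : ℕ) :
    {P : Fq[X][X] | P.natDegree ≤ d ∧ CoeffDegreeLE h P}.Finite := by
  have hfin : {c : Fq[X] | c.natDegree ≤ h}.Finite := by
    have : Finite (degreeLT Fq (h + 1)) :=
      Finite.of_equiv _ (degreeLTEquiv Fq (h + 1)).toEquiv.symm
    refine (Set.toFinite (degreeLT Fq (h + 1) : Set Fq[X])).subset fun c hc => ?_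
    exact mem_degreeLT.mpr (degree_le_natDegree.trans_lt (by exact_mod_cast Nat.lt_succ_of_le hc))
  refine Set.Finite.of_injOn (f := fun P (i : Fin (d + 1)) => P.coeff i)
    (t := Set.univ.pi fun _ => {c : Fq[X] | c.natDegree ≤ h}) ?_ ?_ (Set.Finite.pi fun _ => hfin)
  · exact fun P hP i _ => hP.2 i
  · intro P hP Q hQ hPQ
    ext1 i
    rcases lt_or_ge i (d + 1) with hi | hi
    · exact congrFun hPQ ⟨i, hi⟩
    · rw [coeff_eq_zero_of_natDegree_lt (hP.1.trans_lt hi),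
        coeff_eq_zero_of_natDegree_lt (hQ.1.trans_lt hi)]

/-- Northcott's property: bounded degree and height leave finitely many elements. -/
theorem finite_setOf_heightT_le [Finite Fq] (hq : 1 < q) (d : ℕ) (B : ℝ) :
    {a : AC Fq | IsAlgT Fq a ∧ degT Fq a ≤ d ∧ heightT Fq q a ≤ B}.Finite := by
  obtain ⟨N, hN⟩ := pow_unbounded_of_one_lt B (show (1 : ℝ) < q by exact_mod_cast hq)
  have hinj : Function.Injective (ringHomTC Fq) := by
    rw [injective_iff_map_eq_zero]
    intro c hc
    by_contra hc0
    have h1 := absL_ringHomT Fq q hc0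
    rw [ringHomTC, RingHom.comp_apply, map_eq_zero] at hc
    rw [hc, absL, if_pos rfl] at h1
    have hq0 : (0 : ℝ) < q := by exact_mod_cast zero_lt_one.trans hq
    exact (pow_pos hq0 _).ne h1
  refine ((finite_setOf_coeffDegreeLE (Fq := Fq) d N).biUnion (t := fun P =>
    ((P.map (ringHomTC Fq)).roots.toFinset : Set (AC Fq)))
    fun P _ => Finset.finite_toSet _).subset fun a ha => ?_
  obtain ⟨P, h, hP0, hPd, hP, hPa, hh⟩ := exists_annihilator_heightT q ha.1 ha.2.1
  have hhN : h ≤ N := by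
    have hlt := (ha.2.2.trans_lt hN)
    rw [hh] at hlt
    exact ((pow_lt_pow_iff_right₀ (by exact_mod_cast hq)).mp hlt).le
  refine Set.mem_biUnion (x := P) ⟨hPd, fun i => (hP i).trans hhN⟩ ?_
  simp [(Polynomial.map_ne_zero_iff hinj).mpr hP0, eval_map, hPa]

end Height

/-! ### Sequences of good approximations -/

section Approximation

theorem eventually_le_mul_of_limsup_div_le {u b : ℕ → ℝ} {c ε : ℝ} (hε : 0 < ε)
    (hb : ∀ᶠ j in atTop, 0 < b j)
    (h : limsup (fun j => ((u j / b j : ℝ) : EReal)) atTop ≤ (c : EReal)) :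
    ∀ᶠ j in atTop, u j ≤ (c + ε) * b j := by
  have hlt : (c : EReal) < ((c + ε : ℝ) : EReal) := EReal.coe_lt_coe_iff.mpr (by linarith)
  filter_upwards [eventually_lt_of_limsup_lt (h.trans_lt hlt), hb] with j hj hbj
  exact ((div_lt_iff₀ hbj).mp (EReal.coe_lt_coe_iff.mp hj)).le

theorem eventually_mul_le_of_le_liminf_div {u b : ℕ → ℝ} {c ε : ℝ} (hε : 0 < ε)
    (hb : ∀ᶠ j in atTop, 0 < b j)
    (h : (c : EReal) ≤ liminf (fun j => ((u j / b j : ℝ) : EReal)) atTop) :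
    ∀ᶠ j in atTop, (c - ε) * b j ≤ u j := by
  have hlt : ((c - ε : ℝ) : EReal) < (c : EReal) := EReal.coe_lt_coe_iff.mpr (by linarith)
  filter_upwards [eventually_lt_of_lt_liminf (hlt.trans_le h), hb] with j hj hbj
  exact ((lt_div_iff₀ hbj).mp (EReal.coe_lt_coe_iff.mp hj)).le

variable {Fq : Type} [Field Fq] {q d : ℕ} {ξ : LaurentSeries Fq} {θ ρ δ : ℝ} {α : ℕ → AC Fq}
  {b : ℕ → ℝ}

theorem le_wnStar_of_good_approximations (hq : 1 < q) (hδ : 0 < δ)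
    (hαinj : Function.Injective α) (hαalg : ∀ j, IsAlgT Fq (α j))
    (hαdeg : ∀ j, degT Fq (α j) ≤ d) (hαne : ∀ j, iota Fq ξ ≠ α j)
    (hb : ∀ᶠ j in atTop, 0 < b j)
    (hlower : ((d + δ : ℝ) : EReal) ≤ liminf (fun j : ℕ =>
      ((-Real.log (absC Fq q (iota Fq ξ - α j)) / b j : ℝ) : EReal)) atTop)
    (hheight : limsup (fun j : ℕ =>
      ((Real.log (heightT Fq q (α j)) / b j : ℝ) : EReal)) atTop ≤ ((1 : ℝ) : EReal)) :
    ((d + δ - 1 : ℝ) : EReal) ≤ wnStar Fq q d ξ := by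
  refine EReal.ge_of_forall_gt_iff_ge.mp fun w hw => le_sSup ⟨w, ?_, rfl⟩
  have hw' : w < d + δ - 1 := EReal.coe_lt_coe_iff.mp hw
  set W := max (w + 1) 0 with hW
  have hW0 : 0 ≤ W := le_max_right _ _
  have hWlt : W < d + δ := max_lt (by linarith) (by positivity)
  set ε := (d + δ - W) / (W + 1) with hεdef
  have hε : 0 < ε := div_pos (by linarith) (by linarith)
  have hεeq : ε * (W + 1) = d + δ - W := div_mul_cancel₀ _ (by linarith)
  obtain ⟨J, hJ⟩ := eventually_atTop.mp (((eventually_mul_le_of_le_liminf_div hε hb hlower).and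
    (eventually_le_mul_of_limsup_div_le hε hb hheight)).and hb)
  refine ((Set.Ici_infinite J).image hαinj.injOn).mono ?_
  rintro _ ⟨j, hj, rfl⟩
  obtain ⟨⟨hlow, hhigh⟩, hbj⟩ := hJ j hj
  have hpos := absC_pos hq (sub_ne_zero.mpr (hαne j))
  have hH := one_le_heightT hq (hαalg j)
  refine ⟨hαalg j, hαdeg j, hpos, ?_⟩
  rw [Real.le_rpow_iff_log_le hpos (by linarith)]
  have hlogH := Real.log_nonneg hH
  have h1 : (w + 1) * Real.log (heightT Fq q (α j)) ≤ W * ((1 + ε) * b j) :=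
    (mul_le_mul_of_nonneg_right (le_max_left _ _) hlogH).trans
      (mul_le_mul_of_nonneg_left hhigh hW0)
  have h2 : W * ((1 + ε) * b j) = (d + δ - ε) * b j := by linear_combination b j * hεeq
  linarith

theorem absC_sub_le_absC_sub (hq : 1 < q) {x a c : AC Fq} (ha : IsAlgT Fq a) (hc : IsAlgT Fq c)
    (had : degT Fq a ≤ d) (hcd : degT Fq c ≤ d)
    (h : d * Real.log (heightT Fq q a) + d * Real.log (heightT Fq q c) <
      -Real.log (absC Fq q (x - c))) :
    absC Fq q (x - c) ≤ absC Fq q (x - a) := by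
  by_contra! hlt
  have hne : a ≠ c := fun hac => hlt.ne (by rw [hac])
  have h1 := neg_log_absC_sub_le hq ha hc had hcd hne
  have h2 := absC_sub_le_max hq x a c
  rw [max_eq_right hlt.le] at h2
  have h3 := Real.log_le_log (absC_pos hq (sub_ne_zero.mpr hne.symm)) h2
  linarith

theorem wnStar_le_of_good_approximations [Finite Fq] (hq : 1 < q) (hd : 1 ≤ d)
    (hθ : 0 < θ) (hρ : 0 < ρ) (hδ : 0 < δ) (hαalg : ∀ j, IsAlgT Fq (α j))
    (hαdeg : ∀ j, degT Fq (α j) ≤ d) (hαne : ∀ j, iota Fq ξ ≠ α j)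
    (hbmono : Monotone b) (hblim : Tendsto b atTop atTop)
    (hlower : ((d + δ : ℝ) : EReal) ≤ liminf (fun j : ℕ =>
      ((-Real.log (absC Fq q (iota Fq ξ - α j)) / b j : ℝ) : EReal)) atTop)
    (hupper : limsup (fun j : ℕ =>
      ((-Real.log (absC Fq q (iota Fq ξ - α j)) / b j : ℝ) : EReal)) atTop ≤
        ((d + ρ : ℝ) : EReal))
    (hgrowth : limsup (fun j : ℕ => ((b (j + 1) / b j : ℝ) : EReal)) atTop ≤ (θ : EReal))
    (hheight : limsup (fun j : ℕ =>
      ((Real.log (heightT Fq q (α j)) / b j : ℝ) : EReal)) atTop ≤ ((1 : ℝ) : EReal)) :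
    wnStar Fq q d ξ ≤ (((d + ρ) * ((d : ℝ) * θ / δ) - 1 : ℝ) : EReal) := by
  have hd0 : (0 : ℝ) < d := by exact_mod_cast hd
  have hb := hblim.eventually_gt_atTop 0
  refine sSup_le ?_
  rintro _ ⟨w, hw, rfl⟩
  refine EReal.coe_le_coe_iff.mpr ?_
  by_contra! hlt
  obtain ⟨ε, ⟨hεlt, hδ'⟩, hε⟩ : ∃ ε : ℝ, ((d + ρ + ε) * ((θ + ε) * (d / (δ - ε - d * ε))) < w + 1 ∧
      0 < δ - ε - d * ε) ∧ 0 < ε := by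
    have hcont : ContinuousAt
        (fun ε : ℝ => (d + ρ + ε) * ((θ + ε) * (d / (δ - ε - d * ε)))) 0 := by
      refine ContinuousAt.mul (by fun_prop) (ContinuousAt.mul (by fun_prop)
        (ContinuousAt.div (by fun_prop) (by fun_prop) ?_))
      simpa using hδ.ne'
    have hcont' : ContinuousAt (fun ε : ℝ => δ - ε - d * ε) 0 := by fun_prop
    have e1 := hcont.eventually_lt_const (u := w + 1) (by
      have : (d + ρ + 0) * ((θ + 0) * (d / (δ - 0 - d * 0))) = (d + ρ) * ((d : ℝ) * θ / δ) := by
        rw [mul_zero, sub_zero, sub_zero, add_zero, add_zero]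
        ring
      linarith)
    have e2 := hcont'.eventually_const_lt (u := 0) (by simpa using hδ)
    exact (((e1.and e2).filter_mono nhdsWithin_le_nhds).and
      (self_mem_nhdsWithin : Set.Ioi (0 : ℝ) ∈ nhdsWithin 0 (Set.Ioi 0))).exists
  set δ' := δ - ε - d * ε with hδ'def
  obtain ⟨J, hJ⟩ := eventually_atTop.mp (((eventually_mul_le_of_le_liminf_div hε hb hlower).and
    (eventually_le_mul_of_limsup_div_le hε hb hupper)).and
    (((eventually_le_mul_of_limsup_div_le hε hb hgrowth).and
    (eventually_le_mul_of_limsup_div_le hε hb hheight)).and hb))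
  have hbJ : 0 < b J := (hJ J le_rfl).2.2
  obtain ⟨a, ⟨haalg, hadeg, hapos, hale⟩, hlarge⟩ := (hw.sdiff
    (finite_setOf_heightT_le (Fq := Fq) hq d (Real.exp (b J * δ' / d)))).nonempty
  have hHa := one_le_heightT hq haalg
  have hlogH : b J * δ' / d < Real.log (heightT Fq q a) := by
    rw [Real.lt_log_iff_exp_lt (by linarith)]
    by_contra! hle
    exact hlarge ⟨haalg, hadeg, hle⟩
  set h := Real.log (heightT Fq q a) with hhdef
  have hh0 : 0 < h := lt_trans (by positivity) hlogH
  have hex : ∃ j, h * (d / δ') < b j := (hblim.eventually_gt_atTop _).exists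
  obtain ⟨j, hj, hmin⟩ : ∃ j, h * (d / δ') < b j ∧ ∀ i < j, b i ≤ h * (d / δ') :=
    ⟨Nat.find hex, Nat.find_spec hex, fun i hi => not_lt.mp (Nat.find_min hex hi)⟩
  have hJj : J < j := by
    by_contra! hle
    have h1 : b J < h * (d / δ') := by
      rw [div_lt_iff₀ hd0] at hlogH
      rw [← mul_div_assoc, lt_div_iff₀ hδ']
      exact hlogH
    linarith [hbmono hle]
  obtain ⟨⟨hlow, hupp⟩, ⟨-, hht⟩, hbj⟩ := hJ j hJj.le
  obtain ⟨k, rfl⟩ : ∃ k, j = k + 1 := ⟨j - 1, by omega⟩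
  have hgrow := (hJ k (by omega)).2.1.1
  have hbk := hmin k (by omega)
  have hd' : d * h < δ' * b (k + 1) := by
    rw [← mul_div_assoc, div_lt_iff₀ hδ'] at hj
    linarith
  have hdist : absC Fq q (iota Fq ξ - α (k + 1)) ≤ absC Fq q (iota Fq ξ - a) := by
    refine absC_sub_le_absC_sub hq haalg (hαalg _) hadeg (hαdeg _) ?_
    have h2 := mul_le_mul_of_nonneg_left hht hd0.le
    have h3 : (d + δ - ε) * b (k + 1) = δ' * b (k + 1) + d * ((1 + ε) * b (k + 1)) := by
      rw [hδ'def]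
      ring
    linarith
  have hlogdist := Real.log_le_log (absC_pos hq (sub_ne_zero.mpr (hαne (k + 1)))) hdist
  rw [Real.le_rpow_iff_log_le hapos (by linarith), ← hhdef] at hale
  have h4 : (d + ρ + ε) * b (k + 1) ≤ (d + ρ + ε) * ((θ + ε) * (h * (d / δ'))) := by
    gcongr
    exact hgrow.trans (by gcongr)
  have h5 : (d + ρ + ε) * ((θ + ε) * (h * (d / δ'))) =
      (d + ρ + ε) * ((θ + ε) * (d / δ')) * h := by ring
  have h6 := mul_lt_mul_of_pos_right hεlt hh0
  linarith

end Approximation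

end OotoT

/-- If `ξ` admits a dense sequence of good algebraic approximations
of degree at most `d`, then `d + δ − 1 ≤ w_d^*(ξ) ≤ (d + ρ)·dθ/δ − 1`. -/
theorem wnStar_of_good_approximations (p : ℕ) (hp : p.Prime) (q : ℕ)
    (hq : ∃ e : ℕ, 0 < e ∧ q = p ^ e)
    (Fq : Type) [Field Fq] [Fintype Fq] [CharP Fq p] (hcard : Fintype.card Fq = q)
    (ξ : LaurentSeries Fq) (d : ℕ) (hd : 1 ≤ d)
    (θ ρ δ : ℝ) (hθ : 0 < θ) (hρ : 0 < ρ) (hδ : 0 < δ)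
    (α : ℕ → AC Fq) (β : ℕ → ℝ)
    (hαinj : Function.Injective α)
    (hαalg : ∀ j : ℕ, IsAlgT Fq (α j))
    (hαdeg : ∀ j : ℕ, degT Fq (α j) ≤ d)
    (hαne : ∀ j : ℕ, iota Fq ξ ≠ α j)
    (hβmono : StrictMono β)
    (hβlim : Filter.Tendsto β Filter.atTop Filter.atTop)
    (hβ1 : ∀ j : ℕ, 1 ≤ β j)
    (h1 : ((d + δ : ℝ) : EReal) ≤ Filter.liminf (fun j : ℕ =>
        ((-Real.log (absC Fq q (iota Fq ξ - α j)) / Real.log (β j) : ℝ) : EReal)) Filter.atTop)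
    (h2 : Filter.limsup (fun j : ℕ =>
        ((-Real.log (absC Fq q (iota Fq ξ - α j)) / Real.log (β j) : ℝ) : EReal)) Filter.atTop
        ≤ ((d + ρ : ℝ) : EReal))
    (h3 : Filter.limsup (fun j : ℕ =>
        ((Real.log (β (j + 1)) / Real.log (β j) : ℝ) : EReal)) Filter.atTop ≤ (θ : EReal))
    (h4 : Filter.limsup (fun j : ℕ =>
        ((Real.log (heightT Fq q (α j)) / Real.log (β j) : ℝ) : EReal)) Filter.atTop ≤ 1) :
    ((d + δ - 1 : ℝ) : EReal) ≤ wnStar Fq q d ξ ∧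
      wnStar Fq q d ξ ≤ (((d + ρ) * ((d : ℝ) * θ / δ) - 1 : ℝ) : EReal) := by
  obtain ⟨e, he, hqe⟩ := hq
  have hq1 : 1 < q := hqe ▸ Nat.one_lt_pow he.ne' hp.one_lt
  have hblim : Tendsto (fun j => Real.log (β j)) atTop atTop := Real.tendsto_log_atTop.comp hβlim
  have hbmono : Monotone fun j => Real.log (β j) := fun i j hij =>
    Real.log_le_log (by linarith [hβ1 i]) (hβmono.monotone hij)
  exact ⟨le_wnStar_of_good_approximations hq1 hδ hαinj hαalg hαdeg hαne
      (hblim.eventually_gt_atTop 0) h1 h4,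
    wnStar_le_of_good_approximations hq1 hd hθ hρ hδ hαalg hαdeg hαne hbmono hblim h1 h2 h3 h4⟩
end
end
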